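/- arXiv:2401.06871 — 2 statements merged into one kernel-verified Lean document; each statement's English description precedes it below -/
import Mathlib

section
/- Fix k with 0 < k < +∞. Suppose h : ℍ → ℂ is harmonic, 2-periodic (i.e. h(τ + 2) = h(τ) for all τ ∈ ℍ), and satisfies |h(τ)| = O(1 + (Im τ)^{−k}) uniformly in τ ∈ ℍ. Then there exist unique coefficients cₙ ∈ ℂ (n ∈ ℤ) such that h(τ) = Σ_{n≥0} cₙ e^{iπnτ} + Σ_{n<0} cₙ e^{iπn·conj(τ)} for all τ ∈ ℍ, with the series converging absolutely and uniformly on compact subsets of ℍ, and these coefficients satisfy |cₙ| = O(|n|^k) as |n| → +∞. -/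
open Filter

noncomputable section

/-- A function `h : ℂ → ℂ` is harmonic on the upper half-plane `ℍ` if, writing
`τ = x + iy`, it is twice continuously differentiable as a function of `(x, y)` there
and satisfies `∂²h/∂x² + ∂²h/∂y² = 0` on `ℍ`. -/
def HarmonicOnH (h : ℂ → ℂ) : Prop :=
  ContDiffOn ℝ 2 (fun p : ℝ × ℝ => h ((p.1 : ℂ) + (p.2 : ℂ) * Complex.I))
      {p : ℝ × ℝ | 0 < p.2} ∧
  ∀ τ : ℂ, 0 < τ.im →
    deriv (fun x : ℝ => deriv (fun x' : ℝ => h ((x' : ℂ) + (τ.im : ℂ) * Complex.I)) x) τ.re +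
      deriv (fun y : ℝ => deriv (fun y' : ℝ => h ((τ.re : ℂ) + (y' : ℂ) * Complex.I)) y) τ.im = 0

/-- The `n`-th term of the harmonic Fourier series with coefficients `c : ℤ → ℂ`:
`cₙ e^{iπnτ}` for `n ≥ 0` and `cₙ e^{iπn·conj τ}` for `n < 0`. -/
def fourierTerm (c : ℤ → ℂ) (τ : ℂ) (n : ℤ) : ℂ :=
  c n * Complex.exp (Complex.I * (Real.pi : ℂ) * (n : ℂ) *
    (if 0 ≤ n then τ else starRingEnd ℂ τ))

/-- The harmonic Fourier series with coefficients `c` represents `h` on the upper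
half-plane: it converges pointwise to `h`, converges absolutely, and converges
uniformly on every compact subset of the upper half-plane. -/
def FourierExpansion (c : ℤ → ℂ) (h : ℂ → ℂ) : Prop :=
  (∀ τ : ℂ, 0 < τ.im → HasSum (fun n : ℤ => fourierTerm c τ n) (h τ)) ∧
  (∀ τ : ℂ, 0 < τ.im → Summable (fun n : ℤ => ‖fourierTerm c τ n‖)) ∧
  (∀ K : Set ℂ, K ⊆ {τ : ℂ | 0 < τ.im} → IsCompact K →
    TendstoUniformlyOn (fun (s : Finset ℤ) (τ : ℂ) => ∑ n ∈ s, fourierTerm c τ n) h atTop K)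

/-- Differentiation under the integral sign for a kernel on the strip `[a, b] × (0, ∞)`. -/
theorem hasDerivAt_integral_mul_of_continuousOn {G G' : ℝ × ℝ → ℂ} {e : ℝ → ℂ} {a b : ℝ}
    (hG : ContinuousOn G {p | 0 < p.2}) (hG' : ContinuousOn G' {p | 0 < p.2})
    (he : Continuous e)
    (hderiv : ∀ x y : ℝ, 0 < y → HasDerivAt (fun t : ℝ => G (x, t)) (G' (x, y)) y)
    {y : ℝ} (hy : 0 < y) :
    HasDerivAt (fun t : ℝ => ∫ x in a..b, G (x, t) * e x) (∫ x in a..b, G' (x, y) * e x) y := by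
  have slice : ∀ {F : ℝ × ℝ → ℂ}, ContinuousOn F {p | 0 < p.2} → ∀ t : ℝ, 0 < t →
      Continuous fun x : ℝ => F (x, t) * e x := fun hF t ht =>
    (hF.comp_continuous (f := fun x : ℝ => (x, t)) (by fun_prop) fun _ => ht).mul he
  have hs : Set.Icc (y / 2) (2 * y) ∈ nhds y := Icc_mem_nhds (by linarith) (by linarith)
  have hpos : ∀ t ∈ Set.Icc (y / 2) (2 * y), 0 < t := fun t ht => by linarith [ht.1]
  obtain ⟨M, hM⟩ := (isCompact_uIcc (a := a) (b := b)).prod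
    (isCompact_Icc (a := y / 2) (b := 2 * y)) |>.exists_bound_of_continuousOn
    (f := fun p : ℝ × ℝ => G' p * e p.1)
    ((hG'.mono fun p hp => hpos _ hp.2).mul (by fun_prop))
  refine (intervalIntegral.hasDerivAt_integral_of_dominated_loc_of_deriv_le
    (F := fun t x => G (x, t) * e x) (F' := fun t x => G' (x, t) * e x) (bound := fun _ => M)
    hs ?_ ((slice hG y hy).intervalIntegrable _ _) (slice hG' y hy).aestronglyMeasurable
    ?_ intervalIntegrable_const ?_).2
  · filter_upwards [hs] with t ht using (slice hG t (hpos t ht)).aestronglyMeasurable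
  · exact .of_forall fun x hx t ht => hM (x, t) ⟨Set.uIoc_subset_uIcc hx, ht⟩
  · exact .of_forall fun x _ t ht => (hderiv x t (hpos t ht)).mul_const _

/-- A function with vanishing derivative on `(0, ∞)` is constant there. -/
theorem exists_eq_of_hasDerivAt_zero_Ioi {f : ℝ → ℂ} (hf : ∀ y, 0 < y → HasDerivAt f 0 y) :
    ∃ K, ∀ y, 0 < y → f y = K :=
  ⟨f 1, fun _ hy => isOpen_Ioi.is_const_of_deriv_eq_zero isPreconnected_Ioi
    (fun y hy => (hf y hy).differentiableAt.differentiableWithinAt)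
    (fun y hy => (hf y hy).deriv) hy (Set.mem_Ioi.2 one_pos)⟩

/-- A solution of `a'' = m² a` on `(0, ∞)` with `m ≥ 0` which is bounded on `[1, ∞)` is a multiple
of `exp (-m y)`. -/
theorem exists_eq_mul_exp_neg_of_bounded {a a' : ℝ → ℂ} {m M : ℝ} (hm : 0 ≤ m)
    (ha : ∀ y, 0 < y → HasDerivAt a (a' y) y)
    (ha' : ∀ y, 0 < y → HasDerivAt a' ((m : ℂ) ^ 2 * a y) y)
    (hbdd : ∀ y, 1 ≤ y → ‖a y‖ ≤ M) :
    ∃ c : ℂ, ∀ y, 0 < y → a y = c * (Real.exp (-(m * y)) : ℂ) := by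
  have hexp : ∀ s y : ℝ, HasDerivAt (fun y : ℝ => (Real.exp (s * y) : ℂ))
      (Real.exp (s * y) * s) y := fun s y => by
    have := ((hasDerivAt_id y).const_mul s).exp.ofReal_comp
    simpa using this
  rcases hm.eq_or_lt with rfl | hm
  · obtain ⟨K, hK⟩ := exists_eq_of_hasDerivAt_zero_Ioi (f := a') fun y hy => by
      simpa using ha' y hy
    obtain ⟨L, hL⟩ := exists_eq_of_hasDerivAt_zero_Ioi (f := fun y => a y - K * y) fun y hy => by
      refine ((ha y hy).sub ((Complex.ofRealCLM.hasDerivAt (x := y)).const_mul K)).congr_deriv ?_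
      simp [hK y hy]
    have hK0 : K = 0 := by
      by_contra hne
      have h1 := hbdd (1 + (M + ‖L‖ + 1) / ‖K‖)
      have hKp : 0 < ‖K‖ := norm_pos_iff.2 hne
      have hM : 0 ≤ M := (norm_nonneg _).trans (hbdd 1 le_rfl)
      set y := 1 + (M + ‖L‖ + 1) / ‖K‖ with hy
      have hy1 : 1 ≤ y := by
        have : 0 ≤ (M + ‖L‖ + 1) / ‖K‖ := by positivity
        linarith
      have h2 : K * y = a y - L := by rw [← hL y (by linarith)]; ring
      have h3 : ‖K‖ * y ≤ M + ‖L‖ := by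
        calc ‖K‖ * y = ‖K * y‖ := by
              rw [norm_mul, Complex.norm_real, Real.norm_of_nonneg (by linarith)]
          _ ≤ ‖a y‖ + ‖L‖ := by rw [h2]; exact norm_sub_le _ _
          _ ≤ _ := by linarith [h1 hy1]
      have h4 : ‖K‖ * y = ‖K‖ + (M + ‖L‖ + 1) := by rw [hy]; field_simp
      linarith
    refine ⟨L, fun y hy => ?_⟩
    have := hL y hy
    simpa [hK0] using this
  · obtain ⟨K, hK⟩ := exists_eq_of_hasDerivAt_zero_Ioi
      (f := fun y => (a' y - m * a y) * (Real.exp (m * y) : ℂ)) fun y hy => by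
        refine (((ha' y hy).sub ((ha y hy).const_mul (m : ℂ))).mul (hexp m y)).congr_deriv ?_
        rw [Pi.sub_apply]
        ring
    have hK' : ∀ y, 0 < y → a' y - m * a y = K * (Real.exp (-m * y) : ℂ) := fun y hy => by
      rw [← hK y hy, mul_assoc, ← Complex.ofReal_mul, ← Real.exp_add]; simp
    have hmC : (m : ℂ) ≠ 0 := by exact_mod_cast hm.ne'
    obtain ⟨L, hL⟩ := exists_eq_of_hasDerivAt_zero_Ioi
      (f := fun y => a y * (Real.exp (-m * y) : ℂ) + K / (2 * m) * (Real.exp (-(2 * m) * y) : ℂ))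
      fun y hy => by
        refine (((ha y hy).mul (hexp (-m) y)).add
          ((hexp (-(2 * m)) y).const_mul (K / (2 * m)))).congr_deriv ?_
        rw [sub_eq_iff_eq_add.1 (hK' y hy),
          show -(2 * m) * y = -m * y + -m * y by ring, Real.exp_add]
        push_cast
        field_simp
        ring
    have htend : ∀ s : ℝ, 0 < s → Tendsto (fun y : ℝ => Real.exp (-s * y)) atTop (nhds 0) :=
      fun s hs => Real.tendsto_exp_atBot.comp (tendsto_id.const_mul_atTop_of_neg (by linarith))
    have htendC : ∀ s : ℝ, 0 < s → Tendsto (fun y : ℝ => (Real.exp (-s * y) : ℂ)) atTop (nhds 0) :=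
      fun s hs => by
        rw [← Complex.ofReal_zero]
        exact (Complex.continuous_ofReal.tendsto 0).comp (htend s hs)
    have h1 : Tendsto (fun y : ℝ => a y * (Real.exp (-m * y) : ℂ)) atTop (nhds 0) := by
      refine squeeze_zero_norm' (a := fun y => M * Real.exp (-m * y)) ?_ ?_
      · filter_upwards [eventually_ge_atTop 1] with y hy
        rw [norm_mul, Complex.norm_real, Real.norm_of_nonneg (Real.exp_pos _).le]
        gcongr
        exact hbdd y hy
      · simpa using (htend m hm).const_mul M
    have h2 := h1.add ((htendC (2 * m) (by linarith)).const_mul (K / (2 * m)))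
    have hL0 : L = 0 := by
      refine tendsto_nhds_unique (f := fun _ : ℝ => L) (l := atTop) tendsto_const_nhds ?_
      simp only [mul_zero, add_zero] at h2
      refine h2.congr' ?_
      filter_upwards [eventually_gt_atTop 0] with y hy using hL y hy
    refine ⟨-(K / (2 * m)), fun y hy => ?_⟩
    have h3 := hL y hy
    have hne : (Real.exp (-m * y) : ℂ) ≠ 0 := by exact_mod_cast (Real.exp_pos _).ne'
    rw [hL0, show -(2 * m) * y = -m * y + -m * y by ring, Real.exp_add, Complex.ofReal_mul] at h3
    rw [← neg_mul m y]
    apply mul_right_cancel₀ hne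
    linear_combination h3


theorem hasDerivAt_slice_fst {G : ℝ × ℝ → ℂ} {x y : ℝ} (hG : DifferentiableAt ℝ G (x, y)) :
    HasDerivAt (fun t : ℝ => G (t, y)) (fderiv ℝ G (x, y) (1, 0)) x :=
  hG.hasFDerivAt.comp_hasDerivAt x ((hasDerivAt_id x).prodMk (hasDerivAt_const x y))

theorem hasDerivAt_slice_snd {G : ℝ × ℝ → ℂ} {x y : ℝ} (hG : DifferentiableAt ℝ G (x, y)) :
    HasDerivAt (fun t : ℝ => G (x, t)) (fderiv ℝ G (x, y) (0, 1)) y :=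
  hG.hasFDerivAt.comp_hasDerivAt y ((hasDerivAt_const y x).prodMk (hasDerivAt_id y))

theorem isOpen_halfPlane : IsOpen {p : ℝ × ℝ | 0 < p.2} :=
  isOpen_lt continuous_const continuous_snd

/-- The first and second pure partial derivatives of a harmonic function. -/
theorem HarmonicOnH.exists_partialDerivs {h : ℂ → ℂ} (hh : HarmonicOnH h) :
    ∃ Hx Hxx Hy Hyy : ℝ × ℝ → ℂ,
      ContinuousOn Hxx {p | 0 < p.2} ∧ ContinuousOn Hyy {p | 0 < p.2} ∧
      ContinuousOn Hx {p | 0 < p.2} ∧ ContinuousOn Hy {p | 0 < p.2} ∧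
      (∀ x y : ℝ, 0 < y →
        HasDerivAt (fun t : ℝ => h (t + y * Complex.I)) (Hx (x, y)) x ∧
        HasDerivAt (fun t : ℝ => Hx (t, y)) (Hxx (x, y)) x ∧
        HasDerivAt (fun t : ℝ => h (x + t * Complex.I)) (Hy (x, y)) y ∧
        HasDerivAt (fun t : ℝ => Hy (x, t)) (Hyy (x, y)) y ∧
        Hxx (x, y) + Hyy (x, y) = 0) := by
  obtain ⟨hC, hL⟩ := hh
  set H : ℝ × ℝ → ℂ := fun p => h ((p.1 : ℂ) + (p.2 : ℂ) * Complex.I) with hH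
  have hf : ContDiffOn ℝ 1 (fderiv ℝ H) {p | 0 < p.2} :=
    hC.fderiv_of_isOpen isOpen_halfPlane (by norm_num)
  have hf1 : ∀ v : ℝ × ℝ, ContDiffOn ℝ 1 (fun p => fderiv ℝ H p v) {p | 0 < p.2} :=
    fun v => hf.clm_apply contDiffOn_const
  have hf2 : ∀ v w : ℝ × ℝ,
      ContinuousOn (fun p => fderiv ℝ (fun q => fderiv ℝ H q v) p w) {p | 0 < p.2} :=
    fun v w => ((hf1 v).continuousOn_fderiv_of_isOpen isOpen_halfPlane le_rfl).clm_apply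
      continuousOn_const
  have hd : ∀ x y : ℝ, 0 < y → DifferentiableAt ℝ H (x, y) := fun x y hy =>
    (hC.differentiableOn (by norm_num)).differentiableAt (isOpen_halfPlane.mem_nhds hy)
  have hd1 : ∀ v : ℝ × ℝ, ∀ x y : ℝ, 0 < y →
      DifferentiableAt ℝ (fun p => fderiv ℝ H p v) (x, y) := fun v x y hy =>
    ((hf1 v).differentiableOn (by norm_num)).differentiableAt (isOpen_halfPlane.mem_nhds hy)
  refine ⟨_, _, _, _, hf2 (1, 0) (1, 0), hf2 (0, 1) (0, 1), (hf1 (1, 0)).continuousOn,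
    (hf1 (0, 1)).continuousOn, fun x y hy => ⟨hasDerivAt_slice_fst (hd x y hy),
      hasDerivAt_slice_fst (hd1 _ x y hy), hasDerivAt_slice_snd (hd x y hy),
      hasDerivAt_slice_snd (hd1 _ x y hy), ?_⟩⟩
  have h1 : deriv (fun x : ℝ => deriv (fun x' : ℝ => h ((x' : ℂ) + (y : ℂ) * Complex.I)) x) x =
      fderiv ℝ (fun q => fderiv ℝ H q (1, 0)) (x, y) (1, 0) := by
    rw [← (hasDerivAt_slice_fst (hd1 (1, 0) x y hy)).deriv]
    exact congrArg (deriv · x) (funext fun t => (hasDerivAt_slice_fst (hd t y hy)).deriv)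
  have h2 : deriv (fun y : ℝ => deriv (fun y' : ℝ => h ((x : ℂ) + (y' : ℂ) * Complex.I)) y) y =
      fderiv ℝ (fun q => fderiv ℝ H q (0, 1)) (x, y) (0, 1) := by
    rw [← (hasDerivAt_slice_snd (hd1 (0, 1) x y hy)).deriv]
    refine Filter.EventuallyEq.deriv_eq ?_
    filter_upwards [lt_mem_nhds hy] with t ht using (hasDerivAt_slice_snd (hd x t ht)).deriv
  have h3 := hL (x + y * Complex.I) (by simpa using hy)
  simp only [Complex.add_im, Complex.ofReal_im, Complex.mul_im, Complex.ofReal_re, Complex.I_im,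
    mul_one, Complex.I_re, mul_zero, add_zero, zero_add, Complex.add_re, Complex.mul_re,
    sub_self] at h3
  rw [← h1, ← h2]
  exact h3

/-- Integrating the derivative of a 2-periodic function against a character. -/
theorem integral_deriv_mul_exp {F F' : ℝ → ℂ} (n : ℤ) (hF : ∀ x, HasDerivAt F (F' x) x)
    (hF' : Continuous F') (hper : F 2 = F 0) :
    ∫ x in (0 : ℝ)..2, F' x * Complex.exp (-(Complex.I * Real.pi * n * x)) =
      Complex.I * Real.pi * n *
        ∫ x in (0 : ℝ)..2, F x * Complex.exp (-(Complex.I * Real.pi * n * x)) := by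
  have he : ∀ x : ℝ, HasDerivAt (fun x : ℝ => Complex.exp (-(Complex.I * Real.pi * n * x)))
      (Complex.exp (-(Complex.I * Real.pi * n * x)) * (-(Complex.I * Real.pi * n))) x := fun x =>
    (((Complex.ofRealCLM.hasDerivAt (x := x)).const_mul
      (Complex.I * Real.pi * n)).neg.cexp).congr_deriv (by simp)
  have h2 : Complex.exp (-(Complex.I * Real.pi * n * (2 : ℝ))) = 1 := by
    rw [Complex.exp_eq_one_iff]
    exact ⟨-n, by push_cast; ring⟩
  have hFc : Continuous F := continuous_iff_continuousAt.2 fun x => (hF x).continuousAt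
  have key := intervalIntegral.integral_mul_deriv_eq_deriv_mul (a := 0) (b := 2)
    (fun x _ => hF x) (fun x _ => he x) (hF'.intervalIntegrable _ _)
    (Continuous.intervalIntegrable (by fun_prop) _ _)
  rw [h2, hper] at key
  simp only [Complex.ofReal_zero, mul_zero, neg_zero, Complex.exp_zero, sub_self, zero_sub] at key
  rw [← intervalIntegral.integral_const_mul, ← neg_eq_iff_eq_neg.2 key,
    ← intervalIntegral.integral_neg]
  congr 1 with x
  ring

theorem integral_mul_exp_eq_const_mul_exp_neg {h : ℂ → ℂ} (hh : HarmonicOnH h)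
    (hper : ∀ τ : ℂ, 0 < τ.im → h (τ + 2) = h τ) {M : ℝ} (hbdd : ∀ τ : ℂ, 1 ≤ τ.im → ‖h τ‖ ≤ M)
    (n : ℤ) :
    ∃ c : ℂ, ∀ y : ℝ, 0 < y →
      ∫ x in (0 : ℝ)..2, h (x + y * Complex.I) * Complex.exp (-(Complex.I * Real.pi * n * x)) =
        c * (Real.exp (-(Real.pi * |(n : ℝ)| * y)) : ℂ) := by
  obtain ⟨Hx, Hxx, Hy, Hyy, cxx, cyy, cx, cy, hd⟩ := hh.exists_partialDerivs
  have slice : ∀ {F : ℝ × ℝ → ℂ}, ContinuousOn F {p | 0 < p.2} → ∀ t : ℝ, 0 < t →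
      Continuous fun x : ℝ => F (x, t) := fun hF t ht =>
    hF.comp_continuous (f := fun x : ℝ => (x, t)) (by fun_prop) fun _ => ht
  have hp : ∀ y : ℝ, 0 < y → ∀ t : ℝ, h ((t + 2 : ℝ) + y * Complex.I) = h (t + y * Complex.I) :=
    fun y hy t => by
      rw [← hper (t + y * Complex.I) (by simpa using hy)]
      congr 1; push_cast; ring
  have he : Continuous fun x : ℝ => Complex.exp (-(Complex.I * Real.pi * n * x)) := by fun_prop
  refine exists_eq_mul_exp_neg_of_bounded (M := 2 * M)
    (a' := fun y => ∫ x in (0 : ℝ)..2, Hy (x, y) * Complex.exp (-(Complex.I * Real.pi * n * x)))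
    (by positivity) (fun y hy => ?_) (fun y hy => ?_) fun y hy => ?_
  · exact hasDerivAt_integral_mul_of_continuousOn
      (G := fun p : ℝ × ℝ => h ((p.1 : ℂ) + (p.2 : ℂ) * Complex.I)) hh.1.continuousOn cy he
      (fun x y hy => (hd x y hy).2.2.1) hy
  · refine (hasDerivAt_integral_mul_of_continuousOn cy cyy he
      (fun x y hy => (hd x y hy).2.2.2.1) hy).congr_deriv ?_
    have h1 := integral_deriv_mul_exp n (fun x => (hd x y hy).1) (slice cx y hy)
      (by simpa using hp y hy 0)
    have h2 := integral_deriv_mul_exp n (fun x => (hd x y hy).2.1) (slice cxx y hy) (by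
      have := (hd (0 + 2) y hy).1.comp_add_const 0 2
      rw [funext (hp y hy), zero_add] at this
      exact this.unique (hd 0 y hy).1)
    have h3 : ∀ x : ℝ, Hyy (x, y) = -Hxx (x, y) := fun x =>
      eq_neg_of_add_eq_zero_right (hd x y hy).2.2.2.2
    simp only [h3, neg_mul, intervalIntegral.integral_neg]
    rw [h2, h1]
    have h4 : ((|(n : ℝ)| : ℝ) : ℂ) ^ 2 = (n : ℂ) ^ 2 := by
      rw [← Complex.ofReal_pow, sq_abs]; push_cast; rfl
    push_cast at h4 ⊢
    rw [mul_pow, h4]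
    linear_combination (-(Real.pi : ℂ) ^ 2 * n ^ 2 * ∫ x in (0 : ℝ)..2,
      h (x + y * Complex.I) * Complex.exp (-(Complex.I * Real.pi * n * x))) * Complex.I_sq
  · refine (intervalIntegral.norm_integral_le_of_norm_le_const (C := M) fun x _ => ?_).trans_eq
      (by norm_num [mul_comm])
    rw [norm_mul, show -(Complex.I * Real.pi * n * x) = (-(Real.pi * n * x) : ℝ) * Complex.I by
      push_cast; ring, Complex.norm_exp_ofReal_mul_I, mul_one]
    exact hbdd _ (by simpa using hy)

theorem fourierTerm_eq (c : ℤ → ℂ) (τ : ℂ) (n : ℤ) :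
    fourierTerm c τ n = c n * (Real.exp (-(Real.pi * |(n : ℝ)| * τ.im)) : ℂ) *
      fourier n (τ.re : AddCircle (2 : ℝ)) := by
  have hτ := Complex.re_add_im τ
  have hτ' : starRingEnd ℂ τ = τ.re - τ.im * Complex.I := by
    apply Complex.ext <;> simp
  rw [fourierTerm, fourier_coe_apply, mul_assoc (c n), Complex.ofReal_exp, ← Complex.exp_add]
  congr 2
  split_ifs with hn
  · rw [abs_of_nonneg (by exact_mod_cast hn)]
    conv_lhs => rw [← hτ]
    push_cast
    linear_combination (Real.pi * n * τ.im : ℂ) * Complex.I_sq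
  · rw [abs_of_neg (by exact_mod_cast not_le.1 hn), hτ']
    push_cast
    linear_combination -(Real.pi * n * τ.im : ℂ) * Complex.I_sq

theorem norm_fourierTerm (c : ℤ → ℂ) (τ : ℂ) (n : ℤ) :
    ‖fourierTerm c τ n‖ = ‖c n‖ * Real.exp (-(Real.pi * |(n : ℝ)| * τ.im)) := by
  have : Fact (0 < (2 : ℝ)) := ⟨two_pos⟩
  have h1 : ‖fourier n (τ.re : AddCircle (2 : ℝ))‖ = 1 := by
    rw [fourier_apply, Circle.norm_coe]
  rw [fourierTerm_eq, norm_mul, norm_mul, h1, mul_one, Complex.norm_real,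
    Real.norm_of_nonneg (Real.exp_pos _).le]

theorem summable_exp_neg_mul_abs_int {s : ℝ} (hs : 0 < s) :
    Summable fun n : ℤ => Real.exp (-(s * |(n : ℝ)|)) := by
  have h : Summable fun n : ℕ => Real.exp (-(s * (n : ℝ))) := by
    simpa [mul_comm] using Real.summable_exp_nat_mul_iff.2 (neg_lt_zero.2 hs)
  exact Summable.of_nat_of_neg (by simpa using h) (by simpa using h)

theorem summable_norm_mul_exp_neg {c : ℤ → ℂ}
    (hc : ∀ δ : ℝ, 0 < δ → ∃ M : ℝ, ∀ n : ℤ,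
      ‖c n‖ * Real.exp (-(Real.pi * |(n : ℝ)| * δ)) ≤ M)
    {δ : ℝ} (hδ : 0 < δ) :
    Summable fun n : ℤ => ‖c n‖ * Real.exp (-(Real.pi * |(n : ℝ)| * δ)) := by
  obtain ⟨M, hM⟩ := hc (δ / 2) (half_pos hδ)
  refine .of_nonneg_of_le (fun n => by positivity) (fun n => ?_)
    ((summable_exp_neg_mul_abs_int (s := Real.pi * (δ / 2)) (by positivity)).mul_left M)
  calc ‖c n‖ * Real.exp (-(Real.pi * |(n : ℝ)| * δ))
      = ‖c n‖ * Real.exp (-(Real.pi * |(n : ℝ)| * (δ / 2))) *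
          Real.exp (-(Real.pi * (δ / 2) * |(n : ℝ)|)) := by
        rw [mul_assoc ‖c n‖, ← Real.exp_add]; ring_nf
    _ ≤ _ := by gcongr; exact hM n

/-- The coefficients of a Fourier expansion are the Fourier coefficients on horizontal lines. -/
theorem FourierExpansion.coeff_eq {c : ℤ → ℂ} {h : ℂ → ℂ} (hc : FourierExpansion c h) (n : ℤ) :
    c n = Real.exp (Real.pi * |(n : ℝ)|) *
      ((1 / 2 : ℝ) • ∫ x in (0 : ℝ)..0 + 2,
        fourier (-n) (x : AddCircle (2 : ℝ)) • h (x + (1 : ℝ) * Complex.I)) := by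
  have : Fact (0 < (2 : ℝ)) := ⟨two_pos⟩
  set d : ℤ → ℂ := fun j => c j * (Real.exp (-(Real.pi * |(j : ℝ)| * 1)) : ℂ) with hd
  have hnorm : Summable fun j => ‖d j‖ := by
    refine (hc.2.1 Complex.I (by simp)).congr fun j => ?_
    rw [norm_fourierTerm, hd, norm_mul, Complex.norm_real,
      Real.norm_of_nonneg (Real.exp_pos _).le, Complex.I_im]
  have hsum : Summable fun j => d j • (fourier j : C(AddCircle (2 : ℝ), ℂ)) :=
    .of_norm (by simpa only [norm_smul, fourier_norm, mul_one] using hnorm)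
  obtain ⟨g, hg⟩ := hsum
  have hgx : ∀ x : ℝ, g x = h (x + (1 : ℝ) * Complex.I) := fun x => by
    have h1 := (ContinuousMap.evalCLM ℂ (x : AddCircle (2 : ℝ))).hasSum hg
    refine h1.unique ((hc.1 (x + (1 : ℝ) * Complex.I) (by simp)).congr_fun fun j => ?_)
    simp [fourierTerm_eq, hd]
  have key : fourierCoeff g n = d n := by
    have hL : HasSum (fun j => fourierCoeff (d j • (fourier j : C(AddCircle (2 : ℝ), ℂ))) n)
        (fourierCoeff g n) := by
      have h1 := (ContinuousMap.toLp (E := ℂ) 2 AddCircle.haarAddCircle ℂ).hasSum hg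
      have h2 := (innerSL ℂ (fourierBasis (T := 2) n)).hasSum h1
      simpa only [Function.comp_def, innerSL_apply_apply, ← HilbertBasis.repr_apply_apply,
        fourierBasis_repr, fourierCoeff_toLp] using h2
    have h3 : (fun j => fourierCoeff (d j • (fourier j : C(AddCircle (2 : ℝ), ℂ))) n) =
        fun j => if j = n then d n else 0 := by
      ext j
      rw [ContinuousMap.coe_smul, fourierCoeff.const_smul, fourierCoeff_fourier, Pi.single_apply]
      by_cases hj : j = n
      · subst hj; simp
      · simp [hj, Ne.symm hj]
    rw [h3] at hL
    exact hL.unique (hasSum_ite_eq n (d n))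
  rw [fourierCoeff_eq_intervalIntegral _ _ 0] at key
  simp only [hgx] at key
  rw [key, hd]
  simp only [mul_one]
  rw [mul_left_comm, ← Complex.ofReal_mul, ← Real.exp_add]
  simp

/-- The Fourier series of a continuous 2-periodic function with summable coefficients converges
to the function. -/
theorem hasSum_fourier_of_periodic {f : ℝ → ℂ} (hf : Continuous f)
    (hper : Function.Periodic f 2) {a : ℤ → ℂ}
    (ha : ∀ n : ℤ, ∫ x in (0 : ℝ)..2, f x * Complex.exp (-(Complex.I * Real.pi * n * x)) =
      2 * a n) (hsum : Summable a) (x : ℝ) :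
    HasSum (fun n => a n * fourier n (x : AddCircle (2 : ℝ))) (f x) := by
  have : Fact (0 < (2 : ℝ)) := ⟨two_pos⟩
  let F : C(AddCircle (2 : ℝ), ℂ) := ⟨hper.lift, continuous_coinduced_dom.2 hf⟩
  have hF : ∀ t : ℝ, F t = f t := fun t => hper.lift_coe t
  have hcoeff : fourierCoeff F = a := by
    ext n
    rw [fourierCoeff_eq_intervalIntegral _ _ 0, zero_add]
    have : ∀ t : ℝ, fourier (-n) (t : AddCircle (2 : ℝ)) • F t =
        f t * Complex.exp (-(Complex.I * Real.pi * n * t)) := fun t => by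
      rw [hF, smul_eq_mul, mul_comm, fourier_coe_apply]
      congr 2
      push_cast
      ring
    simp only [this]
    rw [ha]
    simp
  have := has_pointwise_sum_fourier_series_of_summable (f := F) (hcoeff ▸ hsum) x
  simpa [hcoeff, hF] using this

/-- A harmonic, 2-periodic `h : ℍ → ℂ` with
`|h(τ)| = O(1 + (Im τ)^{-k})` has a unique harmonic Fourier series expansion, and its
coefficients satisfy `|cₙ| = O(|n|^k)` as `|n| → ∞`. -/
theorem statement8 (k : ℝ) (hk : 0 < k) (h : ℂ → ℂ)
    (hharm : HarmonicOnH h)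
    (hper : ∀ τ : ℂ, 0 < τ.im → h (τ + 2) = h τ)
    (hgrow : ∃ C : ℝ, ∀ τ : ℂ, 0 < τ.im → ‖h τ‖ ≤ C * (1 + τ.im ^ (-k))) :
    ∃ c : ℤ → ℂ, FourierExpansion c h ∧
      (∃ C N : ℝ, ∀ n : ℤ, N ≤ |(n : ℝ)| → ‖c n‖ ≤ C * |(n : ℝ)| ^ k) ∧
      ∀ c' : ℤ → ℂ, FourierExpansion c' h → c' = c := by
  obtain ⟨C, hC⟩ := hgrow
  have hC0 : 0 ≤ C := by
    have := (norm_nonneg _).trans (hC Complex.I (by simp))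
    simp only [Complex.I_im, Real.one_rpow] at this
    linarith
  have hbdd : ∀ τ : ℂ, 1 ≤ τ.im → ‖h τ‖ ≤ C * (1 + 1) := fun τ hτ => by
    refine (hC τ (by linarith)).trans ?_
    gcongr
    exact Real.rpow_le_one_of_one_le_of_nonpos hτ (by linarith)
  choose c₀ hc₀ using integral_mul_exp_eq_const_mul_exp_neg hharm hper hbdd
  set c : ℤ → ℂ := fun n => c₀ n / 2 with hcdef
  have hbound : ∀ y : ℝ, 0 < y → ∀ n : ℤ,
      ‖c n‖ * Real.exp (-(Real.pi * |(n : ℝ)| * y)) ≤ C * (1 + y ^ (-k)) := fun y hy n => by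
    have h1 : ‖∫ x in (0 : ℝ)..2, h (x + y * Complex.I) *
        Complex.exp (-(Complex.I * Real.pi * n * x))‖ ≤ C * (1 + y ^ (-k)) * |2 - 0| :=
      intervalIntegral.norm_integral_le_of_norm_le_const fun x _ => by
        rw [norm_mul, show -(Complex.I * Real.pi * n * x) =
          (-(Real.pi * n * x) : ℝ) * Complex.I by push_cast; ring,
          Complex.norm_exp_ofReal_mul_I, mul_one]
        simpa using hC (x + y * Complex.I) (by simpa using hy)
    rw [hc₀ n y hy, norm_mul, Complex.norm_real, Real.norm_of_nonneg (Real.exp_pos _).le] at h1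
    norm_num at h1
    rw [hcdef, norm_div, Complex.norm_two]
    linarith
  have hsummable : ∀ y : ℝ, 0 < y →
      Summable fun n : ℤ => ‖c n‖ * Real.exp (-(Real.pi * |(n : ℝ)| * y)) := fun y hy =>
    summable_norm_mul_exp_neg (fun δ hδ => ⟨_, hbound δ hδ⟩) hy
  have hhas : ∀ τ : ℂ, 0 < τ.im → HasSum (fun n : ℤ => fourierTerm c τ n) (h τ) := fun τ hτ => by
    have hsum : Summable fun n : ℤ => c n * (Real.exp (-(Real.pi * |(n : ℝ)| * τ.im)) : ℂ) :=
      .of_norm ((hsummable τ.im hτ).congr fun n => by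
        rw [norm_mul, Complex.norm_real, Real.norm_of_nonneg (Real.exp_pos _).le])
    have hcont : Continuous fun x : ℝ => h (x + τ.im * Complex.I) :=
      hharm.1.continuousOn.comp_continuous (f := fun x : ℝ => (x, τ.im)) (by fun_prop) fun _ => hτ
    have hp : Function.Periodic (fun x : ℝ => h (x + τ.im * Complex.I)) 2 := fun x => by
      beta_reduce
      rw [← hper (x + τ.im * Complex.I) (by simpa using hτ)]
      congr 1; push_cast; ring
    have := hasSum_fourier_of_periodic hcont hp
      (fun n => by rw [hc₀ n τ.im hτ, hcdef]; ring) hsum τ.re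
    simpa only [fourierTerm_eq, Complex.re_add_im] using this
  have hexp : FourierExpansion c h := by
    refine ⟨hhas, fun τ hτ => ?_, fun K hK hKc => ?_⟩
    · simpa only [norm_fourierTerm] using hsummable τ.im hτ
    · rcases K.eq_empty_or_nonempty with rfl | hne
      · exact tendstoUniformlyOn_empty
      obtain ⟨τ₀, hτ₀, hmin⟩ := hKc.exists_isMinOn hne Complex.continuous_im.continuousOn
      refine (tendstoUniformlyOn_tsum (f := fun (n : ℤ) τ => fourierTerm c τ n)
        (hsummable τ₀.im (hK hτ₀)) fun n τ hτ => ?_).congr_right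
          fun τ hτ => (hhas τ (hK hτ)).tsum_eq
      rw [norm_fourierTerm]
      gcongr
      exact hmin hτ
  refine ⟨c, hexp, ⟨2 * C * Real.exp Real.pi, 1, fun n hn => ?_⟩, fun c' hc' => ?_⟩
  · have hn0 : 0 < |(n : ℝ)| := by linarith
    have h1 := hbound |(n : ℝ)|⁻¹ (by positivity) n
    rw [mul_assoc, mul_inv_cancel₀ hn0.ne', mul_one, Real.inv_rpow hn0.le,
      Real.rpow_neg hn0.le, inv_inv] at h1
    have h2 : 1 ≤ |(n : ℝ)| ^ k := Real.one_le_rpow hn hk.le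
    calc ‖c n‖ = ‖c n‖ * Real.exp (-Real.pi) * Real.exp Real.pi := by
          rw [mul_assoc, ← Real.exp_add]; simp
      _ ≤ C * (1 + |(n : ℝ)| ^ k) * Real.exp Real.pi := by gcongr
      _ ≤ C * (|(n : ℝ)| ^ k + |(n : ℝ)| ^ k) * Real.exp Real.pi := by gcongr
      _ = _ := by ring
  · ext n
    rw [hc'.coeff_eq, hexp.coeff_eq]

end
end

section
/- Let f : ℍ → ℂ be any harmonic function. Then there exist coefficients a₀ ∈ ℂ and aₙ, bₙ ∈ ℂ (n ∈ ℤ \ {0}) with subexponential growth (for every ε > 0, |aₙ|, |bₙ| = O(e^{ε|n|}) as |n| → +∞) such that f(τ) = a₀ + Σ_{n>0} (aₙ e^{iπnτ} + bₙ e^{−iπn/τ}) + Σ_{n<0} (aₙ e^{iπn·conj(τ)} + bₙ e^{−iπn/conj(τ)}) for all τ ∈ ℍ, the series converging absolutely and uniformly on compact subsets of ℍ. -/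
open Filter

noncomputable section

/-- The `n`-th term of the harmonic hyperbolic Fourier series with coefficients
`a b : ℤ → ℂ` at a point `τ` of the upper half-plane: for `n > 0` the term
`aₙ e^{iπnτ} + bₙ e^{-iπn/τ}`, for `n < 0` the term
`aₙ e^{iπn·conj τ} + bₙ e^{-iπn/conj τ}`, and the constant `a₀` for `n = 0`. -/
def hfsTerm (a b : ℤ → ℂ) (τ : ℂ) (n : ℤ) : ℂ :=
  if 0 < n then
    a n * Complex.exp (Complex.I * (Real.pi : ℂ) * (n : ℂ) * τ)
      + b n * Complex.exp (-(Complex.I * (Real.pi : ℂ) * (n : ℂ)) / τ)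
  else if n < 0 then
    a n * Complex.exp (Complex.I * (Real.pi : ℂ) * (n : ℂ) * (starRingEnd ℂ τ))
      + b n * Complex.exp (-(Complex.I * (Real.pi : ℂ) * (n : ℂ)) / (starRingEnd ℂ τ))
  else a 0

namespace HyperbolicFourier

open Complex Topology

/-- The square of the Jacobi theta function `θ₃`. -/
def thetaSq (τ : ℂ) : ℂ := jacobiTheta τ ^ 2

/-- The square of the Jacobi theta function `θ₄`. -/
def thetaSq' (τ : ℂ) : ℂ := jacobiTheta (τ + 1) ^ 2

/-- The square of the Jacobi theta function `θ₂`, defined by inversion from `θ₄`. -/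
def thetaSq'' (τ : ℂ) : ℂ := thetaSq' (-1 / τ) / (-I * τ)

lemma im_neg_one_div (τ : ℂ) : (-1 / τ).im = τ.im / normSq τ := by
  simp [neg_div]

lemma ne_zero_of_im_pos {τ : ℂ} (hτ : 0 < τ.im) : τ ≠ 0 := by
  rintro rfl; simp at hτ

lemma im_neg_one_div_pos {τ : ℂ} (hτ : 0 < τ.im) : 0 < (-1 / τ).im := by
  rw [im_neg_one_div]
  exact div_pos hτ (normSq_pos.2 (ne_zero_of_im_pos hτ))

lemma hasSum_jacobiTheta {τ : ℂ} (hτ : 0 < τ.im) :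
    HasSum (fun n : ℤ => cexp (Real.pi * I * (n : ℂ) ^ 2 * τ)) (jacobiTheta τ) := by
  simpa [jacobiTheta_eq_jacobiTheta₂, jacobiTheta₂_term] using hasSum_jacobiTheta₂_term 0 hτ

lemma exp_theta_add_one (n : ℤ) (τ : ℂ) :
    cexp (Real.pi * I * (n : ℂ) ^ 2 * (τ + 1)) =
      (-1) ^ n * cexp (Real.pi * I * (n : ℂ) ^ 2 * τ) := by
  rw [mul_add, Complex.exp_add, mul_comm]
  congr 1
  have h : (Real.pi * I * (n : ℂ) ^ 2 * 1) = ((n ^ 2 : ℤ) : ℂ) * (Real.pi * I) := by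
    push_cast; ring
  rw [h, exp_int_mul, exp_pi_mul_I]
  rcases Int.even_or_odd n with hn | hn
  · rw [hn.neg_one_zpow, Even.neg_one_zpow (by simpa [Int.even_pow] using hn)]
  · rw [hn.neg_one_zpow, Odd.neg_one_zpow (by simpa using hn.pow)]

lemma hasSum_jacobiTheta_add_one {τ : ℂ} (hτ : 0 < τ.im) :
    HasSum (fun n : ℤ => (-1) ^ n * cexp (Real.pi * I * (n : ℂ) ^ 2 * τ))
      (jacobiTheta (τ + 1)) := by
  simpa only [exp_theta_add_one] using hasSum_jacobiTheta (τ := τ + 1) (by simpa using hτ)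

/-- Sums over `ℤ × ℤ` supported on pairs of equal parity. -/
lemma hasSum_of_even_sublattice {f : ℤ × ℤ → ℂ} {s : ℂ}
    (hf : ∀ m n : ℤ, Odd (m + n) → f (m, n) = 0) :
    HasSum (fun p : ℤ × ℤ => f (p.1 + p.2, p.1 - p.2)) s ↔ HasSum f s := by
  have hinj : Function.Injective (fun p : ℤ × ℤ => (p.1 + p.2, p.1 - p.2)) := by
    rintro ⟨a, b⟩ ⟨c, d⟩ h
    simp only [Prod.mk.injEq] at h ⊢
    omega
  refine hinj.hasSum_iff (f := f) ?_
  rintro ⟨m, n⟩ hmn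
  apply hf
  by_contra h
  rw [Int.not_odd_iff_even] at h
  obtain ⟨k, hk⟩ := h
  exact hmn ⟨(k, m - k), by simp only [Prod.mk.injEq]; omega⟩

lemma HasSum.mul_int {f g : ℤ → ℂ} {s t : ℂ} (hf : HasSum f s) (hg : HasSum g t) :
    HasSum (fun p : ℤ × ℤ => f p.1 * g p.2) (s * t) :=
  hf.mul hg (summable_mul_of_summable_norm hf.summable.norm hg.summable.norm)

lemma HasSum.congr_fun {ι : Type*} {f g : ι → ℂ} {s : ℂ} (hf : HasSum f s) (h : ∀ i, g i = f i) :
    HasSum g s :=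
  funext h ▸ hf

lemma thetaSq_add_thetaSq' {τ : ℂ} (hτ : 0 < τ.im) :
    thetaSq τ + thetaSq' τ = 2 * thetaSq (2 * τ) := by
  have h2 : 0 < (2 * τ).im := by simpa using hτ
  have h3 := hasSum_jacobiTheta hτ
  have h4 := hasSum_jacobiTheta_add_one hτ
  have hd := hasSum_jacobiTheta h2
  have hs := (HasSum.mul_int h3 h3).add (HasSum.mul_int h4 h4)
  have hs2 := (HasSum.mul_int hd hd).mul_left 2
  rw [← hasSum_of_even_sublattice] at hs
  · simp only [thetaSq, thetaSq', sq]
    refine hs.unique ?_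
    refine HasSum.congr_fun hs2 fun p => ?_
    have e1 : ((-1 : ℂ)) ^ (p.1 + p.2) * (-1) ^ (p.1 - p.2) = 1 := by
      rw [← zpow_add₀ (neg_ne_zero.2 one_ne_zero)]
      exact Even.neg_one_zpow ⟨p.1, by ring⟩
    rw [mul_mul_mul_comm ((-1 : ℂ) ^ (p.1 + p.2)), e1, ← Complex.exp_add, ← Complex.exp_add,
      one_mul, ← two_mul]
    push_cast
    ring_nf
  · intro m n hmn
    have e1 : ((-1 : ℂ)) ^ m * (-1) ^ n = -1 := by
      rw [← zpow_add₀ (neg_ne_zero.2 one_ne_zero)]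
      exact hmn.neg_one_zpow
    simp only
    rw [mul_mul_mul_comm ((-1 : ℂ) ^ m), e1]
    ring

lemma jacobiTheta_mul_jacobiTheta_add_one {τ : ℂ} (hτ : 0 < τ.im) :
    jacobiTheta τ * jacobiTheta (τ + 1) = thetaSq' (2 * τ) := by
  have h2 : 0 < (2 * τ).im := by simpa using hτ
  have h3 := hasSum_jacobiTheta hτ
  have h4 := hasSum_jacobiTheta_add_one hτ
  have hd := hasSum_jacobiTheta_add_one h2
  have hs := (HasSum.mul_int h3 h4).add (HasSum.mul_int h4 h3)
  have hs2 := (HasSum.mul_int hd hd).mul_left 2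
  rw [← hasSum_of_even_sublattice] at hs
  · have key : jacobiTheta τ * jacobiTheta (τ + 1) + jacobiTheta (τ + 1) * jacobiTheta τ
        = 2 * (jacobiTheta (2 * τ + 1) * jacobiTheta (2 * τ + 1)) := by
      refine hs.unique ?_
      refine HasSum.congr_fun hs2 fun p => ?_
      have e1 : ((-1 : ℂ)) ^ (p.1 - p.2) = (-1) ^ p.1 * (-1) ^ p.2 := by
        rw [sub_eq_add_neg, zpow_add₀ (neg_ne_zero.2 one_ne_zero), zpow_neg, ← inv_zpow]
        norm_num
      have e2 : ((-1 : ℂ)) ^ (p.1 + p.2) = (-1) ^ p.1 * (-1) ^ p.2 := by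
        rw [← zpow_add₀ (neg_ne_zero.2 one_ne_zero)]
      simp only [e1, e2]
      set u := (-1 : ℂ) ^ p.1
      set v := (-1 : ℂ) ^ p.2
      have e3 : cexp (Real.pi * I * ((p.1 + p.2 : ℤ) : ℂ) ^ 2 * τ) *
          cexp (Real.pi * I * ((p.1 - p.2 : ℤ) : ℂ) ^ 2 * τ) =
          cexp (Real.pi * I * (p.1 : ℂ) ^ 2 * (2 * τ)) *
          cexp (Real.pi * I * (p.2 : ℂ) ^ 2 * (2 * τ)) := by
        rw [← Complex.exp_add, ← Complex.exp_add]
        push_cast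
        ring_nf
      linear_combination (2 * u * v) * e3
    simp only [thetaSq', sq]
    linear_combination key / 2
  · intro m n hmn
    have e1 : ((-1 : ℂ)) ^ m + (-1) ^ n = 0 := by
      rcases Int.even_or_odd m with hm | hm
      · have hn : Odd n := by grind
        rw [hm.neg_one_zpow, hn.neg_one_zpow]; ring
      · have hn : Even n := by grind
        rw [hm.neg_one_zpow, hn.neg_one_zpow]; ring
    simp only
    linear_combination (cexp (Real.pi * I * (m : ℂ) ^ 2 * τ) *
      cexp (Real.pi * I * (n : ℂ) ^ 2 * τ)) * e1

lemma thetaSq_mul_thetaSq' {τ : ℂ} (hτ : 0 < τ.im) :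
    thetaSq τ * thetaSq' τ = thetaSq' (2 * τ) ^ 2 := by
  rw [← jacobiTheta_mul_jacobiTheta_add_one hτ, thetaSq, thetaSq', mul_pow]

lemma jacobiTheta_add_two (τ : ℂ) : jacobiTheta (τ + 2) = jacobiTheta τ := by
  rw [add_comm, jacobiTheta_two_add]

lemma thetaSq_add_one (τ : ℂ) : thetaSq (τ + 1) = thetaSq' τ := rfl

lemma thetaSq'_add_one (τ : ℂ) : thetaSq' (τ + 1) = thetaSq τ := by
  rw [thetaSq', thetaSq, add_assoc, one_add_one_eq_two, jacobiTheta_add_two]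

lemma thetaSq_neg_one_div {τ : ℂ} (hτ : 0 < τ.im) : thetaSq (-1 / τ) = -I * τ * thetaSq τ := by
  have h := jacobiTheta_S_smul ⟨τ, hτ⟩
  have h2 : ((ModularGroup.S • (⟨τ, hτ⟩ : UpperHalfPlane) : UpperHalfPlane) : ℂ) = -1 / τ := by
    rw [UpperHalfPlane.modular_S_smul]
    simp [neg_div, ← inv_neg]
  rw [h2] at h
  rw [thetaSq, h, mul_pow, thetaSq]
  congr 1
  rw [← cpow_nat_mul]
  norm_num

lemma thetaSq'_neg_one_div {τ : ℂ} (hτ : 0 < τ.im) :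
    thetaSq' (-1 / τ) = -I * τ * thetaSq'' τ := by
  have := ne_zero_of_im_pos hτ
  rw [thetaSq'']
  field_simp

lemma thetaSq_eq_add {τ : ℂ} (hτ : 0 < τ.im) :
    thetaSq τ = thetaSq (2 * τ) + thetaSq'' (2 * τ) := by
  have h0 := ne_zero_of_im_pos hτ
  have h2 : 0 < (2 * τ).im := by simpa using hτ
  have h := thetaSq_add_thetaSq' (im_neg_one_div_pos h2)
  rw [thetaSq_neg_one_div h2, thetaSq'_neg_one_div h2,
    show 2 * (-1 / (2 * τ)) = -1 / τ by field_simp, thetaSq_neg_one_div hτ] at h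
  have : I * τ ≠ 0 := mul_ne_zero I_ne_zero h0
  apply mul_left_cancel₀ this
  linear_combination h / 2

lemma thetaSq'_eq_sub {τ : ℂ} (hτ : 0 < τ.im) :
    thetaSq' τ = thetaSq (2 * τ) - thetaSq'' (2 * τ) := by
  linear_combination thetaSq_add_thetaSq' hτ - thetaSq_eq_add hτ

lemma thetaSq''_sq {τ : ℂ} (hτ : 0 < τ.im) :
    thetaSq'' τ ^ 2 = 4 * thetaSq (2 * τ) * thetaSq'' (2 * τ) := by
  have h0 := ne_zero_of_im_pos hτ
  have h2 : 0 < (2 * τ).im := by simpa using hτ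
  have h := thetaSq_mul_thetaSq' (im_neg_one_div_pos h2)
  rw [thetaSq_neg_one_div h2, thetaSq'_neg_one_div h2,
    show 2 * (-1 / (2 * τ)) = -1 / τ by field_simp, thetaSq'_neg_one_div hτ] at h
  have : (I * τ) ^ 2 ≠ 0 := pow_ne_zero _ (mul_ne_zero I_ne_zero h0)
  apply mul_left_cancel₀ this
  linear_combination -h

/-- Jacobi's quartic identity. -/
lemma jacobi_identity {τ : ℂ} (hτ : 0 < τ.im) :
    thetaSq τ ^ 2 = thetaSq'' τ ^ 2 + thetaSq' τ ^ 2 := by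
  rw [thetaSq''_sq hτ, thetaSq_eq_add hτ, thetaSq'_eq_sub hτ]
  ring

lemma tendsto_jacobiTheta : Tendsto jacobiTheta (comap im atTop) (𝓝 1) := by
  have h := isBigO_at_im_infty_jacobiTheta_sub_one
  have h0 : Tendsto (fun τ : ℂ => Real.exp (-Real.pi * τ.im)) (comap im atTop) (𝓝 0) := by
    refine Real.tendsto_exp_atBot.comp ?_
    exact tendsto_comap.const_mul_atTop_of_neg (neg_lt_zero.2 Real.pi_pos)
  have h1 := h.trans_tendsto h0
  simpa using h1.add_const 1

lemma tendsto_thetaSq : Tendsto thetaSq (comap im atTop) (𝓝 1) := by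
  simpa [thetaSq] using! tendsto_jacobiTheta.pow 2

lemma tendsto_add_one_comap_im : Tendsto (fun τ : ℂ => τ + 1) (comap im atTop) (comap im atTop) :=
  tendsto_comap_iff.2 (by simpa [Function.comp_def] using! tendsto_comap)

lemma tendsto_thetaSq' : Tendsto thetaSq' (comap im atTop) (𝓝 1) :=
  tendsto_thetaSq.comp tendsto_add_one_comap_im

lemma thetaSq_ne_zero_and_thetaSq'_ne_zero {τ : ℂ} (hτ : 0 < τ.im) :
    thetaSq τ ≠ 0 ∧ thetaSq' τ ≠ 0 := by
  have hstep : ∀ σ : ℂ, 0 < σ.im → thetaSq' (2 * σ) ≠ 0 → thetaSq σ ≠ 0 ∧ thetaSq' σ ≠ 0 := by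
    intro σ hσ h
    rw [← mul_ne_zero_iff, thetaSq_mul_thetaSq' hσ]
    exact pow_ne_zero _ h
  have hlim : Tendsto (fun n : ℕ => (2 : ℂ) ^ n * (2 * τ)) atTop (comap im atTop) := by
    refine tendsto_comap_iff.2 ?_
    have : (im ∘ fun n : ℕ => (2 : ℂ) ^ n * (2 * τ)) = fun n => (2 : ℝ) ^ n * (2 * τ.im) := by
      ext n
      have : (2 : ℂ) ^ n = ((2 ^ n : ℝ) : ℂ) := by push_cast; rfl
      simp [Function.comp_apply, this, -ofReal_pow]
    rw [this]
    exact (tendsto_pow_atTop_atTop_of_one_lt one_lt_two).atTop_mul_const (by positivity)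
  have hdesc : ∀ n : ℕ, ∀ σ : ℂ, 0 < σ.im → thetaSq' (2 ^ n * σ) ≠ 0 → thetaSq' σ ≠ 0 := by
    intro n
    induction n with
    | zero => intro σ _ h; simpa using h
    | succ k ih =>
      intro σ hσ h
      refine (hstep σ hσ (ih (2 * σ) (by simpa using hσ) ?_)).2
      rwa [← mul_assoc, ← pow_succ]
  obtain ⟨n, hn⟩ := ((tendsto_thetaSq'.comp hlim).eventually_ne one_ne_zero).exists
  exact hstep τ hτ (hdesc n (2 * τ) (by simpa using hτ) hn)

lemma thetaSq_ne_zero {τ : ℂ} (hτ : 0 < τ.im) : thetaSq τ ≠ 0 :=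
  (thetaSq_ne_zero_and_thetaSq'_ne_zero hτ).1

lemma thetaSq'_ne_zero {τ : ℂ} (hτ : 0 < τ.im) : thetaSq' τ ≠ 0 :=
  (thetaSq_ne_zero_and_thetaSq'_ne_zero hτ).2

lemma thetaSq''_ne_zero {τ : ℂ} (hτ : 0 < τ.im) : thetaSq'' τ ≠ 0 :=
  div_ne_zero (thetaSq'_ne_zero (im_neg_one_div_pos hτ))
    (mul_ne_zero (neg_ne_zero.2 I_ne_zero) (ne_zero_of_im_pos hτ))

/-- The upper half-plane as a subset of `ℂ`. -/
def upperHalf : Set ℂ := {τ | 0 < τ.im}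

lemma isOpen_upperHalf : IsOpen upperHalf := isOpen_lt continuous_const continuous_im

lemma convex_upperHalf : Convex ℝ upperHalf := convex_halfSpace_im_gt 0

lemma upperHalf_mem_nhds {τ : ℂ} (hτ : 0 < τ.im) : upperHalf ∈ 𝓝 τ := isOpen_upperHalf.mem_nhds hτ

lemma differentiableAt_neg_one_div {τ : ℂ} (hτ : τ ≠ 0) :
    DifferentiableAt ℂ (fun τ : ℂ => -1 / τ) τ :=
  (differentiableAt_const _).div differentiableAt_id hτ

lemma differentiableAt_thetaSq {τ : ℂ} (hτ : 0 < τ.im) : DifferentiableAt ℂ thetaSq τ :=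
  (differentiableAt_jacobiTheta hτ).pow 2

lemma differentiableAt_thetaSq' {τ : ℂ} (hτ : 0 < τ.im) : DifferentiableAt ℂ thetaSq' τ :=
  (differentiableAt_thetaSq (τ := τ + 1) (by simpa using hτ)).comp τ
    (differentiableAt_id.add_const 1)

lemma differentiableAt_thetaSq'' {τ : ℂ} (hτ : 0 < τ.im) : DifferentiableAt ℂ thetaSq'' τ := by
  refine DifferentiableAt.div ?_ (differentiableAt_id.const_mul _)
    (mul_ne_zero (neg_ne_zero.2 I_ne_zero) (ne_zero_of_im_pos hτ))
  exact (differentiableAt_thetaSq' (im_neg_one_div_pos hτ)).comp τ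
    (differentiableAt_neg_one_div (ne_zero_of_im_pos hτ))

/-- The modular lambda function. -/
def lam (τ : ℂ) : ℂ := 1 - (thetaSq' τ / thetaSq τ) ^ 2

lemma lam_eq_sq {τ : ℂ} (hτ : 0 < τ.im) : lam τ = (thetaSq'' τ / thetaSq τ) ^ 2 := by
  have := thetaSq_ne_zero hτ
  rw [lam]
  field_simp
  linear_combination jacobi_identity hτ

lemma lam_neg_one_div {τ : ℂ} (hτ : 0 < τ.im) : lam (-1 / τ) = 1 - lam τ := by
  have := thetaSq_ne_zero hτ
  have := ne_zero_of_im_pos hτ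
  rw [lam_eq_sq hτ, lam, thetaSq_neg_one_div hτ, thetaSq'_neg_one_div hτ]
  field_simp

lemma one_sub_lam_ne_zero {τ : ℂ} (hτ : 0 < τ.im) : 1 - lam τ ≠ 0 := by
  simpa [lam] using ⟨thetaSq'_ne_zero hτ, thetaSq_ne_zero hτ⟩

lemma lam_ne_zero {τ : ℂ} (hτ : 0 < τ.im) : lam τ ≠ 0 := by
  rw [lam_eq_sq hτ]
  exact pow_ne_zero _ (div_ne_zero (thetaSq''_ne_zero hτ) (thetaSq_ne_zero hτ))

lemma lam_add_one {τ : ℂ} (hτ : 0 < τ.im) : lam (τ + 1) = lam τ / (lam τ - 1) := by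
  have h1 := thetaSq_ne_zero hτ
  have h2 := thetaSq'_ne_zero hτ
  have h3 : lam τ - 1 ≠ 0 := by rw [← neg_sub]; exact neg_ne_zero.2 (one_sub_lam_ne_zero hτ)
  rw [eq_div_iff h3, lam, lam, thetaSq_add_one, thetaSq'_add_one]
  field_simp
  ring

lemma lam_add_two (τ : ℂ) : lam (τ + 2) = lam τ := by
  rw [← one_add_one_eq_two, ← add_assoc]
  simp only [lam, thetaSq_add_one, thetaSq'_add_one]

lemma lam_periodic : Function.Periodic lam 2 := lam_add_two

lemma tendsto_lam : Tendsto lam (comap im atTop) (𝓝 0) := by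
  have := (tendsto_thetaSq'.div tendsto_thetaSq one_ne_zero).pow 2
  simpa [lam] using! this.const_sub 1

lemma differentiableAt_lam {τ : ℂ} (hτ : 0 < τ.im) : DifferentiableAt ℂ lam τ :=
  (((differentiableAt_thetaSq' hτ).div (differentiableAt_thetaSq hτ)
    (thetaSq_ne_zero hτ)).pow 2).const_sub 1

lemma differentiableOn_lam : DifferentiableOn ℂ lam upperHalf := fun _ h =>
  (differentiableAt_lam h).differentiableWithinAt

lemma jacobiTheta_neg_conj (τ : ℂ) :
    jacobiTheta (-(starRingEnd ℂ τ)) = starRingEnd ℂ (jacobiTheta τ) := by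
  rw [jacobiTheta_eq_jacobiTheta₂, jacobiTheta_eq_jacobiTheta₂, jacobiTheta₂_conj]
  simp

lemma lam_neg_conj (τ : ℂ) : lam (-(starRingEnd ℂ τ)) = starRingEnd ℂ (lam τ) := by
  have h : thetaSq' (-(starRingEnd ℂ τ)) = starRingEnd ℂ (thetaSq' τ) := by
    have e : -(starRingEnd ℂ τ) + 1 = -(starRingEnd ℂ (τ - 1)) := by simp; ring
    have e' : τ + 1 = τ - 1 + 2 := by ring
    rw [thetaSq', thetaSq', map_pow, e, e', jacobiTheta_add_two, jacobiTheta_neg_conj]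
  simp only [lam, h, thetaSq, jacobiTheta_neg_conj, map_sub, map_pow, map_div₀, map_one]

lemma neg_one_div_of_norm_eq_one {τ : ℂ} (h : ‖τ‖ = 1) : -1 / τ = -(starRingEnd ℂ τ) := by
  rw [neg_div, one_div, Complex.inv_def, normSq_eq_norm_sq, h]; simp

lemma re_lam_of_norm_eq_one {τ : ℂ} (hτ : 0 < τ.im) (h : ‖τ‖ = 1) : (lam τ).re = 1 / 2 := by
  have h1 := lam_neg_one_div hτ
  rw [neg_one_div_of_norm_eq_one h, lam_neg_conj] at h1
  have := congrArg re h1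
  simp at this
  linarith

lemma comap_im_neBot : (comap im atTop).NeBot :=
  comap_neBot_iff_frequently.2 (Eventually.frequently (Eventually.of_forall fun y => ⟨⟨0, y⟩, rfl⟩))

lemma lam_not_const (c : ℂ) (h : ∀ τ : ℂ, 0 < τ.im → lam τ = c) : False := by
  have := comap_im_neBot
  have h0 : c = 0 := by
    refine tendsto_nhds_unique (f := lam) (l := comap im atTop) ?_ tendsto_lam
    refine tendsto_const_nhds.congr' ?_
    filter_upwards [preimage_mem_comap (Ioi_mem_atTop 0)] with τ hτ using (h τ hτ).symm
  exact lam_ne_zero (τ := I) (by simp) ((h I (by simp)).trans h0)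

lemma deriv_lam_eq_zero_iff {τ : ℂ} (hτ : 0 < τ.im) :
    deriv lam τ = 0 ↔ deriv lam (2 * τ) = 0 := by
  have h2 : 0 < (2 * τ).im := by simpa using hτ
  set x : ℂ → ℂ := fun σ => thetaSq'' (2 * σ) / thetaSq (2 * σ) with hx
  have hm : DifferentiableAt ℂ (fun σ : ℂ => 2 * σ) τ := differentiableAt_id.const_mul _
  have hxd : HasDerivAt x (deriv x τ) τ :=
    (((differentiableAt_thetaSq'' h2).comp τ hm).div ((differentiableAt_thetaSq h2).comp τ hm)
      (thetaSq_ne_zero h2)).hasDerivAt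
  have hx0 : x τ ≠ 0 := div_ne_zero (thetaSq''_ne_zero h2) (thetaSq_ne_zero h2)
  have hP := thetaSq_ne_zero h2
  have hx1 : 1 + x τ ≠ 0 := by
    have h := thetaSq_ne_zero hτ
    rw [thetaSq_eq_add hτ] at h
    contrapose! h
    simp only [hx] at h
    field_simp at h
    simpa using h
  have hx2 : 1 - x τ ≠ 0 := by
    have h := thetaSq'_ne_zero hτ
    rw [thetaSq'_eq_sub hτ] at h
    contrapose! h
    simp only [hx] at h
    field_simp at h
    simpa using h
  have e1 : lam =ᶠ[𝓝 τ] fun σ => 4 * x σ / (1 + x σ) ^ 2 := by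
    filter_upwards [upperHalf_mem_nhds hτ] with σ hσ
    have hσ' : 0 < σ.im := hσ
    have := thetaSq_ne_zero (τ := 2 * σ) (by simpa using hσ')
    have h := thetaSq_ne_zero hσ'
    rw [lam_eq_sq hσ', div_pow, thetaSq''_sq hσ']
    rw [thetaSq_eq_add hσ'] at h ⊢
    simp only [hx]
    field_simp
  have d1 : deriv lam τ = 4 * deriv x τ * (1 - x τ) / (1 + x τ) ^ 3 := by
    rw [e1.deriv_eq]
    have := (hxd.const_mul 4).div ((hxd.const_add 1).pow 2) (pow_ne_zero 2 hx1)
    refine (HasDerivAt.deriv this).trans ?_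
    simp only [Pi.pow_apply]
    field_simp
    simp
    ring
  have e2 : (fun σ => lam (2 * σ)) =ᶠ[𝓝 τ] fun σ => x σ ^ 2 := by
    filter_upwards [upperHalf_mem_nhds hτ] with σ hσ
    have hσ' : 0 < σ.im := hσ
    rw [lam_eq_sq (by simpa using hσ')]
  have d2 : 2 * deriv lam (2 * τ) = 2 * x τ * deriv x τ := by
    have a := ((differentiableAt_lam h2).hasDerivAt.comp τ ((hasDerivAt_id τ).const_mul 2)).deriv
    have b := (hxd.pow 2).deriv
    have c := e2.deriv_eq
    simp only [Function.comp_def] at a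
    rw [a] at c
    rw [show (fun σ => x σ ^ 2) = x ^ 2 from rfl, b] at c
    simp at c
    linear_combination c
  have d3 : deriv lam (2 * τ) = x τ * deriv x τ := by linear_combination d2 / 2
  rw [d1, d3]
  simp [hx0, hx1, hx2]

lemma deriv_lam_add_two (τ : ℂ) : deriv lam (τ + 2) = deriv lam τ := by
  rw [← deriv_comp_add_const]
  simp only [lam_add_two]

lemma deriv_lam_pow_mul_eq_zero_iff (n : ℕ) {τ : ℂ} (hτ : 0 < τ.im) :
    deriv lam τ = 0 ↔ deriv lam (2 ^ n * τ) = 0 := by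
  induction n generalizing τ with
  | zero => simp
  | succ k ih =>
    rw [deriv_lam_eq_zero_iff hτ, ih (τ := 2 * τ) (by simpa using hτ), pow_succ, mul_assoc]

lemma deriv_lam_ne_zero {τ : ℂ} (hτ : 0 < τ.im) : deriv lam τ ≠ 0 := by
  intro h
  have hz : ∀ n : ℕ, deriv lam (τ + 2 / 2 ^ n) = 0 := by
    intro n
    have him : 0 < (τ + 2 / 2 ^ n).im := by
      have : (2 : ℂ) / 2 ^ n = ((2 / 2 ^ n : ℝ) : ℂ) := by push_cast; rfl
      rw [this, add_im, ofReal_im, add_zero]; exact hτ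
    rw [deriv_lam_pow_mul_eq_zero_iff n him, mul_add, mul_div_cancel₀ _ (pow_ne_zero n two_ne_zero),
      deriv_lam_add_two, ← deriv_lam_pow_mul_eq_zero_iff n hτ]
    exact h
  have han : AnalyticOnNhd ℂ (deriv lam) upperHalf :=
    (differentiableOn_lam.analyticOnNhd isOpen_upperHalf).deriv
  have hlim : Tendsto (fun n : ℕ => τ + 2 / 2 ^ n) atTop (𝓝[≠] τ) := by
    refine tendsto_nhdsWithin_iff.2 ⟨?_, Eventually.of_forall fun n => by simp⟩
    have : Tendsto (fun n : ℕ => 2 * ((1 / 2 : ℂ)) ^ n) atTop (𝓝 (2 * 0)) :=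
      (tendsto_pow_atTop_nhds_zero_of_norm_lt_one (by norm_num)).const_mul 2
    simpa [div_eq_mul_inv] using this.const_add τ
  have hfreq : ∃ᶠ z in 𝓝[≠] τ, deriv lam z = 0 :=
    hlim.frequently (Eventually.of_forall hz).frequently
  have hzero := han.eqOn_zero_of_preconnected_of_frequently_eq_zero
    convex_upperHalf.isPreconnected hτ hfreq
  obtain ⟨c, hc⟩ := isOpen_upperHalf.exists_is_const_of_deriv_eq_zero
    convex_upperHalf.isPreconnected differentiableOn_lam hzero
  exact lam_not_const c hc

/-- Reduction of a complex number modulo `2ℤ` to the strip `|Re τ| ≤ 1`. -/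
def red (τ : ℂ) : ℂ := τ - 2 * (round (τ.re / 2) : ℤ)

lemma red_im (τ : ℂ) : (red τ).im = τ.im := by simp [red]

lemma red_re (τ : ℂ) : (red τ).re = τ.re - 2 * (round (τ.re / 2) : ℤ) := by simp [red]

lemma abs_red_re_le (τ : ℂ) : |(red τ).re| ≤ 1 := by
  have h := abs_sub_round (τ.re / 2)
  rw [red_re, show τ.re - 2 * (round (τ.re / 2) : ℤ) = 2 * (τ.re / 2 - (round (τ.re / 2) : ℤ)) by ring,
    abs_mul, abs_two]
  linarith

lemma red_add_two (τ : ℂ) : red (τ + 2) = red τ := by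
  have : (τ + 2).re / 2 = τ.re / 2 + 1 := by simp; ring
  rw [red, red, this, round_add_one]
  push_cast
  ring

lemma norm_red_le (τ : ℂ) (n : ℤ) : ‖red τ‖ ≤ ‖τ - 2 * n‖ := by
  rw [← sq_le_sq₀ (norm_nonneg _) (norm_nonneg _), ← normSq_eq_norm_sq, ← normSq_eq_norm_sq,
    normSq_apply, normSq_apply, red_im, red_re]
  have h := round_le (τ.re / 2) n
  have h2 := sq_le_sq.2 h
  simp
  nlinarith

lemma continuous_norm_red : Continuous fun τ => ‖red τ‖ := by
  have h : ∀ σ τ : ℂ, ‖red σ‖ ≤ ‖red τ‖ + 1 * dist σ τ := by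
    intro σ τ
    refine (norm_red_le σ (round (τ.re / 2))).trans ?_
    have : σ - 2 * (round (τ.re / 2) : ℤ) = red τ + (σ - τ) := by rw [red]; ring
    rw [this, one_mul, dist_eq]
    exact norm_add_le _ _
  exact (LipschitzWith.of_le_add_mul 1 (by simpa using h)).continuous

lemma _root_.Function.Periodic.apply_red {α : Type*} {f : ℂ → α} (hf : Function.Periodic f 2)
    (τ : ℂ) : f (red τ) = f τ := by
  have := hf.sub_int_mul_eq (x := τ) (round (τ.re / 2))
  rw [← this, red, mul_comm]

lemma lam_red (τ : ℂ) : lam (red τ) = lam τ := lam_periodic.apply_red τ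

lemma red_eq_self_of_norm_le {τ : ℂ} (hτ : 0 < τ.im) (h : ‖τ‖ ≤ 1) : red τ = τ := by
  have h1 : |τ.re| < 1 := by
    have : τ.re ^ 2 + τ.im ^ 2 ≤ 1 := by
      have := normSq_eq_norm_sq τ
      rw [normSq_apply] at this
      nlinarith [norm_nonneg τ]
    exact (sq_lt_one_iff_abs_lt_one _).1 (by nlinarith)
  have : round (τ.re / 2) = 0 := by
    rw [round_eq_zero_iff]
    rw [abs_lt] at h1
    constructor <;> linarith
  simp [red, this]

lemma norm_sq_eq (τ : ℂ) : ‖τ‖ ^ 2 = τ.re ^ 2 + τ.im ^ 2 := by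
  rw [← normSq_eq_norm_sq, normSq_apply]; ring

lemma norm_le_norm_red {τ : ℂ} (h : |τ.re| ≤ 1) : ‖τ‖ ≤ ‖red τ‖ := by
  rw [← sq_le_sq₀ (norm_nonneg _) (norm_nonneg _), norm_sq_eq, norm_sq_eq, red_im, red_re]
  set n : ℤ := round (τ.re / 2)
  rw [abs_le] at h
  rcases lt_trichotomy n 0 with hn | hn | hn
  · have : (n : ℝ) ≤ -1 := by exact_mod_cast Int.le_sub_one_of_lt hn
    nlinarith
  · simp [hn]
  · have : (1 : ℝ) ≤ n := by exact_mod_cast hn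
    nlinarith

/-- The quotient `λ / (1 - λ)`. -/
def lamRatio (τ : ℂ) : ℂ := lam τ / (1 - lam τ)

lemma lamRatio_red (τ : ℂ) : lamRatio (red τ) = lamRatio τ := by
  rw [lamRatio, lamRatio, lam_red]

lemma differentiableOn_lamRatio : DifferentiableOn ℂ lamRatio upperHalf :=
  differentiableOn_lam.div (differentiableOn_lam.const_sub 1) fun _ h => one_sub_lam_ne_zero h

lemma lam_eq_of_lamRatio {τ : ℂ} (hτ : 0 < τ.im) : lam τ = lamRatio τ / (1 + lamRatio τ) := by
  have := one_sub_lam_ne_zero hτ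
  have h : 1 + lamRatio τ = 1 / (1 - lam τ) := by rw [lamRatio]; field_simp; ring
  rw [h, lamRatio]
  field_simp

lemma norm_lamRatio_of_norm_eq_one {τ : ℂ} (hτ : 0 < τ.im) (h : ‖τ‖ = 1) : ‖lamRatio τ‖ = 1 := by
  have h1 := lam_neg_one_div hτ
  rw [neg_one_div_of_norm_eq_one h, lam_neg_conj] at h1
  rw [lamRatio, norm_div, ← h1, norm_conj, div_self]
  exact norm_ne_zero_iff.2 (lam_ne_zero hτ)

lemma lamRatio_one_sub {w : ℂ} (hw : 0 < w.im) : lamRatio (1 + -1 / w) = lam w - 1 := by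
  have h1 := lam_ne_zero hw
  rw [lamRatio, add_comm, lam_add_one (im_neg_one_div_pos hw), lam_neg_one_div hw]
  have : (1 - lam w) / (1 - lam w - 1) = (lam w - 1) / lam w := by
    rw [show 1 - lam w - 1 = - lam w by ring, show 1 - lam w = -(lam w - 1) by ring, neg_div_neg_eq]
  rw [this]
  field_simp
  ring

lemma lamRatio_neg_one_sub {w : ℂ} (hw : 0 < w.im) : lamRatio (-1 + -1 / w) = lam w - 1 := by
  rw [← lamRatio_one_sub hw, lamRatio, lamRatio, ← lam_add_two]
  congr 2 <;> ring_nf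

lemma eventually_comap_im {p : ℂ → Prop} (h : ∀ᶠ τ in comap im atTop, p τ) :
    ∃ H : ℝ, 0 < H ∧ ∀ τ : ℂ, H ≤ τ.im → p τ := by
  rw [eventually_comap] at h
  obtain ⟨H, hH⟩ := eventually_atTop.1 h
  exact ⟨max H 1, by simp, fun τ hτ => hH τ.im ((le_max_left _ _).trans hτ) τ rfl⟩

lemma exists_norm_lam_lt {ε : ℝ} (hε : 0 < ε) :
    ∃ H : ℝ, 0 < H ∧ ∀ τ : ℂ, H ≤ τ.im → ‖lam τ‖ < ε := by
  refine eventually_comap_im ?_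
  simpa using tendsto_lam.norm.eventually_lt_const (u := ε) (by simpa using hε)

/-- The lower boundary of the fundamental strip is high up when seen from the cusp `±1`. -/
lemma im_one_div_one_sub {x y : ℝ} (hx : 0 ≤ x) (hx1 : x ≤ 1) (hy : 0 < y) (hy1 : y ≤ 1)
    (h : 1 ≤ x ^ 2 + y ^ 2) : 1 / (2 * y) ≤ y / ((1 - x) ^ 2 + y ^ 2) := by
  rw [div_le_div_iff₀ (by positivity) (by positivity)]
  have : 1 - x ≤ y ^ 2 := by nlinarith
  have h3 : (1 - x) ^ 2 ≤ y ^ 2 := by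
    have : 1 - x ≤ y := by nlinarith
    nlinarith
  nlinarith

lemma exists_norm_lamRatio_lt {ε : ℝ} (hε : 0 < ε) :
    ∃ y₀ : ℝ, 0 < y₀ ∧ ∀ τ : ℂ, 0 < τ.im → τ.im < y₀ → |τ.re| ≤ 1 → 1 ≤ ‖τ‖ →
      ‖lamRatio τ‖ < 1 + ε := by
  obtain ⟨H, hH, hlam⟩ := exists_norm_lam_lt hε
  refine ⟨min 1 (1 / (2 * H)), by positivity, fun τ hτ hτ1 hre hn => ?_⟩
  have hy1 : τ.im ≤ 1 := (hτ1.trans_le (min_le_left _ _)).le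
  have hy2 : H ≤ 1 / (2 * τ.im) := by
    have := (hτ1.trans_le (min_le_right _ _)).le
    rw [le_div_iff₀ (by positivity)] at this ⊢
    linarith
  have hn2 : 1 ≤ τ.re ^ 2 + τ.im ^ 2 := by
    rw [← norm_sq_eq]; nlinarith
  have hbound : ∀ w : ℂ, H ≤ w.im → ‖lam w - 1‖ < 1 + ε := by
    intro w hw
    have := hlam w hw
    refine (norm_sub_le _ _).trans_lt ?_
    rw [norm_one]; linarith
  rw [abs_le] at hre
  rcases le_total 0 τ.re with hx | hx
  · set w : ℂ := -1 / (τ - 1) with hw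
    have him : w.im = τ.im / ((1 - τ.re) ^ 2 + τ.im ^ 2) := by
      rw [hw, im_neg_one_div, normSq_apply]; simp; ring
    have hHw : H ≤ w.im := by
      rw [him]; exact hy2.trans (im_one_div_one_sub hx hre.2 hτ hy1 hn2)
    have hne : τ - 1 ≠ 0 := ne_zero_of_im_pos (by simpa using hτ)
    have e : τ = 1 + -1 / w := by rw [hw]; field_simp; ring
    rw [e, lamRatio_one_sub (hH.trans_le hHw)]
    exact hbound w hHw
  · set w : ℂ := -1 / (τ + 1) with hw
    have him : w.im = τ.im / ((1 - (-τ.re)) ^ 2 + τ.im ^ 2) := by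
      rw [hw, im_neg_one_div, normSq_apply]; simp; ring
    have hHw : H ≤ w.im := by
      rw [him]
      exact hy2.trans (im_one_div_one_sub (by linarith) (by linarith) hτ hy1 (by simpa using hn2))
    have hne : τ + 1 ≠ 0 := ne_zero_of_im_pos (by simpa using hτ)
    have e : τ = -1 + -1 / w := by rw [hw]; field_simp; ring
    rw [e, lamRatio_neg_one_sub (hH.trans_le hHw)]
    exact hbound w hHw

lemma not_isMax_lamRatio {τ : ℂ} (hτ : 0 < τ.im) (h1 : 1 < ‖red τ‖)
    (hmax : ∀ σ : ℂ, 0 < σ.im → 1 ≤ ‖red σ‖ → ‖lamRatio σ‖ ≤ ‖lamRatio τ‖) : False := by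
  have hd : ∀ᶠ σ in 𝓝 τ, DifferentiableAt ℂ lamRatio σ := by
    filter_upwards [upperHalf_mem_nhds hτ] with σ hσ
    exact differentiableOn_lamRatio.differentiableAt (upperHalf_mem_nhds hσ)
  have hloc : IsLocalMax (norm ∘ lamRatio) τ := by
    filter_upwards [upperHalf_mem_nhds hτ, continuous_norm_red.continuousAt.eventually_const_lt h1]
      with σ hσ hσ1
    exact hmax σ hσ hσ1.le
  have hev := Complex.eventually_eq_of_isLocalMax_norm hd hloc
  have han := differentiableOn_lamRatio.analyticOnNhd isOpen_upperHalf
  have heq := han.eqOn_of_preconnected_of_eventuallyEq analyticOnNhd_const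
    convex_upperHalf.isPreconnected hτ hev
  refine lam_not_const (lamRatio τ / (1 + lamRatio τ)) fun σ hσ => ?_
  rw [lam_eq_of_lamRatio hσ, heq hσ]

lemma norm_lamRatio_le_one {τ : ℂ} (hτ : 0 < τ.im) (h1 : 1 ≤ ‖red τ‖) : ‖lamRatio τ‖ ≤ 1 := by
  by_contra! hgt
  obtain ⟨y₀, hy₀, hlow⟩ := exists_norm_lamRatio_lt (sub_pos.2 hgt)
  obtain ⟨H, hH, hhigh⟩ := exists_norm_lam_lt (ε := 1 / 3) (by norm_num)
  have hhigh' : ∀ σ : ℂ, H ≤ σ.im → ‖lamRatio σ‖ ≤ 1 := by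
    intro σ hσ
    have h := hhigh σ hσ
    have h2 : 2 / 3 ≤ ‖1 - lam σ‖ := by
      have := norm_sub_norm_le 1 (lam σ)
      rw [norm_one] at this
      linarith
    rw [lamRatio, norm_div]
    exact div_le_one_of_le₀ (by linarith) (norm_nonneg _)
  set K : Set ℂ := (Set.Icc (-1) 1 ×ℂ Set.Icc y₀ H) ∩ {σ | 1 ≤ ‖σ‖} with hK
  have hKc : IsCompact K := (isCompact_Icc.reProdIm isCompact_Icc).inter_right
    (isClosed_le continuous_const continuous_norm)
  have hKmem : ∀ σ : ℂ, 0 < σ.im → 1 ≤ ‖red σ‖ → ‖lamRatio τ‖ ≤ ‖lamRatio σ‖ → red σ ∈ K := by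
    intro σ hσ hσ1 hle
    rw [← lamRatio_red σ] at hle
    refine ⟨⟨abs_le.1 (abs_red_re_le σ), ?_, ?_⟩, hσ1⟩
    · by_contra! hlt
      have := hlow (red σ) (by rwa [red_im]) hlt (abs_red_re_le σ) hσ1
      linarith
    · by_contra! hlt
      have := hhigh' (red σ) hlt.le
      linarith
  have hKim : ∀ σ ∈ K, 0 < σ.im := fun σ hσ => hy₀.trans_le hσ.1.2.1
  have hcont : ContinuousOn (fun σ => ‖lamRatio σ‖) K :=
    (differentiableOn_lamRatio.continuousOn.mono hKim).norm
  obtain ⟨σ, hσK, hσmax⟩ := hKc.exists_isMaxOn ⟨_, hKmem τ hτ h1 le_rfl⟩ hcont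
  have hτσ : ‖lamRatio τ‖ ≤ ‖lamRatio σ‖ := by
    rw [← lamRatio_red τ]; exact hσmax (hKmem τ hτ h1 le_rfl)
  have hσ := hKim σ hσK
  have hglob : ∀ ρ : ℂ, 0 < ρ.im → 1 ≤ ‖red ρ‖ → ‖lamRatio ρ‖ ≤ ‖lamRatio σ‖ := by
    intro ρ hρ hρ1
    rcases le_total ‖lamRatio τ‖ ‖lamRatio ρ‖ with h | h
    · rw [← lamRatio_red ρ]; exact hσmax (hKmem ρ hρ hρ1 h)
    · exact h.trans hτσ
  have hσn : 1 ≤ ‖red σ‖ := hσK.2.trans (norm_le_norm_red (abs_le.2 hσK.1.1))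
  rcases hσn.eq_or_lt with h | h
  · have := norm_lamRatio_of_norm_eq_one (τ := red σ) (by rwa [red_im]) h.symm
    rw [lamRatio_red] at this
    linarith
  · exact not_isMax_lamRatio hσ h hglob

lemma norm_lamRatio_lt_one {τ : ℂ} (hτ : 0 < τ.im) (h1 : 1 < ‖red τ‖) : ‖lamRatio τ‖ < 1 := by
  refine lt_of_le_of_ne (norm_lamRatio_le_one hτ h1.le) fun h => ?_
  exact not_isMax_lamRatio hτ h1 fun σ hσ hσ1 => (norm_lamRatio_le_one hσ hσ1).trans h.ge

lemma re_lam_lt {τ : ℂ} (hτ : 0 < τ.im) (h1 : 1 < ‖red τ‖) : (lam τ).re < 1 / 2 := by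
  have h := norm_lamRatio_lt_one hτ h1
  rw [lamRatio, norm_div, div_lt_one (norm_pos_iff.2 (one_sub_lam_ne_zero hτ)),
    ← sq_lt_sq₀ (norm_nonneg _) (norm_nonneg _), norm_sq_eq, norm_sq_eq] at h
  simp at h
  nlinarith

/-- The modular lambda function, rotated and centred so that it is real on the unit semicircle and
maps the fundamental strip above it to the upper half-plane. -/
def Y (τ : ℂ) : ℂ := -I * (lam τ - 1 / 2)

lemma Y_im (τ : ℂ) : (Y τ).im = 1 / 2 - (lam τ).re := by simp [Y]

lemma Y_im_pos {τ : ℂ} (hτ : 0 < τ.im) (h1 : 1 < ‖red τ‖) : 0 < (Y τ).im := by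
  rw [Y_im]; linarith [re_lam_lt hτ h1]

lemma Y_im_eq_zero {τ : ℂ} (hτ : 0 < τ.im) (h : ‖τ‖ = 1) : (Y τ).im = 0 := by
  rw [Y_im, re_lam_of_norm_eq_one hτ h, sub_self]

lemma Y_im_nonneg {τ : ℂ} (hτ : 0 < τ.im) (h : 1 ≤ ‖red τ‖) : 0 ≤ (Y τ).im := by
  rcases h.eq_or_lt with h | h
  · have := Y_im_eq_zero (τ := red τ) (by rwa [red_im]) h.symm
    rw [Y_im, lam_red, ← Y_im] at this
    exact this.ge
  · exact (Y_im_pos hτ h).le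

lemma Y_neg_one_div {τ : ℂ} (hτ : 0 < τ.im) : Y (-1 / τ) = -Y τ := by
  rw [Y, Y, lam_neg_one_div hτ]; ring

lemma Y_add_two (τ : ℂ) : Y (τ + 2) = Y τ := by rw [Y, Y, lam_add_two]

lemma differentiableAt_Y {τ : ℂ} (hτ : 0 < τ.im) : DifferentiableAt ℂ Y τ :=
  ((differentiableAt_lam hτ).sub_const _).const_mul _

lemma differentiableOn_Y : DifferentiableOn ℂ Y upperHalf := fun _ h =>
  (differentiableAt_Y h).differentiableWithinAt

lemma deriv_Y_ne_zero {τ : ℂ} (hτ : 0 < τ.im) : deriv Y τ ≠ 0 := by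
  have : HasDerivAt Y (-I * deriv lam τ) τ :=
    ((differentiableAt_lam hτ).hasDerivAt.sub_const _).const_mul _
  rw [this.deriv]
  exact mul_ne_zero (neg_ne_zero.2 I_ne_zero) (deriv_lam_ne_zero hτ)

/-- A parametrization of the unit semicircle by the real line. -/
def arc (t : ℝ) : ℂ := 1 - 2 / (1 + I * Real.exp t)

lemma arc_den_ne_zero (t : ℝ) : 1 + I * (Real.exp t : ℂ) ≠ 0 := fun h => by
  have := congrArg re h
  simp [-ofReal_exp] at this

lemma arc_den_ne_zero' (t : ℝ) : -1 + I * (Real.exp t : ℂ) ≠ 0 := fun h => by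
  have := congrArg re h
  simp [-ofReal_exp] at this

lemma arc_eq (t : ℝ) : arc t =
    ((Real.exp t ^ 2 - 1) / (Real.exp t ^ 2 + 1) : ℝ) +
      (2 * Real.exp t / (Real.exp t ^ 2 + 1) : ℝ) * I := by
  have h1 := arc_den_ne_zero t
  have h2 : (Real.exp t : ℂ) ^ 2 + 1 ≠ 0 := by
    norm_cast; positivity
  rw [arc]
  push_cast [-ofReal_exp]
  field_simp
  ring_nf
  simp only [I_sq]
  ring

lemma arc_im (t : ℝ) : (arc t).im = 2 * Real.exp t / (Real.exp t ^ 2 + 1) := by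
  rw [arc_eq]
  simp only [add_im, ofReal_im, mul_im, ofReal_re, I_re, I_im]
  ring

lemma arc_re (t : ℝ) : (arc t).re = (Real.exp t ^ 2 - 1) / (Real.exp t ^ 2 + 1) := by
  rw [arc_eq]
  simp only [add_re, ofReal_im, mul_re, ofReal_re, I_re, I_im]
  ring

lemma arc_im_pos (t : ℝ) : 0 < (arc t).im := by
  rw [arc_im]; positivity

lemma norm_arc (t : ℝ) : ‖arc t‖ = 1 := by
  rw [← sq_eq_sq₀ (norm_nonneg _) zero_le_one, norm_sq_eq, arc_im, arc_re]
  field_simp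
  ring

lemma arc_neg (t : ℝ) : arc (-t) = -1 / arc t := by
  have h := arc_den_ne_zero t
  have h' := arc_den_ne_zero' t
  have h3 : (Real.exp t : ℂ) ≠ 0 := by exact_mod_cast (Real.exp_pos t).ne'
  have h4 : (Real.exp t : ℂ) + I ≠ 0 := fun h => by
    have := congrArg im h
    simp [-ofReal_exp] at this
  rw [arc, arc, Real.exp_neg, ofReal_inv]
  set u := (Real.exp t : ℂ)
  have e1 : 1 + I * u⁻¹ = (u + I) / u := by field_simp
  have e2 : 1 - 2 / (1 + I * u) = (-1 + I * u) / (1 + I * u) := by field_simp; ring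
  have e3 : 1 - 2 / ((u + I) / u) = (I - u) / (u + I) := by field_simp; ring
  rw [e1, e2, e3, div_div_eq_mul_div, div_eq_div_iff h4 h']
  linear_combination (2 * u) * I_sq

lemma exists_arc_eq {τ : ℂ} (hτ : 0 < τ.im) (h : ‖τ‖ = 1) : ∃ t, arc t = τ := by
  have hn : τ.re ^ 2 + τ.im ^ 2 = 1 := by rw [← norm_sq_eq, h, one_pow]
  have hx : 0 < 1 - τ.re := by nlinarith
  refine ⟨Real.log (τ.im / (1 - τ.re)), ?_⟩
  have hp : 0 < τ.im / (1 - τ.re) := by positivity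
  apply Complex.ext
  · rw [arc_re, Real.exp_log hp]
    field_simp
    rw [show τ.im ^ 2 = (1 - τ.re) * (1 + τ.re) by linear_combination hn]
    field_simp
    ring
  · rw [arc_im, Real.exp_log hp]
    field_simp
    rw [show τ.im ^ 2 = (1 - τ.re) * (1 + τ.re) by linear_combination hn]
    ring

lemma hasDerivAt_arc (t : ℝ) :
    HasDerivAt arc (2 * (I * Real.exp t) / (1 + I * Real.exp t) ^ 2) t := by
  have h1 : HasDerivAt (fun t : ℝ => (Real.exp t : ℂ)) (Real.exp t : ℂ) t :=
    (Real.hasDerivAt_exp t).ofReal_comp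
  have h2 := (((h1.const_mul I).const_add 1).inv (arc_den_ne_zero t)).const_mul 2
  have h3 := h2.const_sub 1
  refine h3.congr_deriv ?_
  ring

/-- The coordinate `Y` along the semicircle. -/
def arcY (t : ℝ) : ℝ := (Y (arc t)).re

lemma arcY_eq (t : ℝ) : (arcY t : ℂ) = Y (arc t) := by
  apply Complex.ext
  · simp [arcY]
  · simp [Y_im_eq_zero (arc_im_pos t) (norm_arc t)]

lemma arcY_neg (t : ℝ) : arcY (-t) = -arcY t := by
  rw [arcY, arcY, arc_neg, Y_neg_one_div (arc_im_pos t), neg_re]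

lemma hasDerivAt_arcY (t : ℝ) : ∃ c : ℝ, c ≠ 0 ∧ HasDerivAt arcY c t := by
  have h := (differentiableAt_Y (arc_im_pos t)).hasDerivAt.comp t (hasDerivAt_arc t)
  set d := deriv Y (arc t) * (2 * (I * Real.exp t) / (1 + I * Real.exp t) ^ 2) with hd
  have hd0 : d ≠ 0 := by
    refine mul_ne_zero (deriv_Y_ne_zero (arc_im_pos t)) (div_ne_zero ?_ ?_)
    · exact mul_ne_zero two_ne_zero (mul_ne_zero I_ne_zero
        (by exact_mod_cast (Real.exp_pos t).ne'))
    · exact pow_ne_zero _ (arc_den_ne_zero t)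
  have hre : HasDerivAt arcY d.re t := by
    simpa [Function.comp_def] using! reCLM.hasFDerivAt.comp_hasDerivAt t h
  have him : HasDerivAt (fun t => (Y (arc t)).im) d.im t := by
    simpa [Function.comp_def] using! imCLM.hasFDerivAt.comp_hasDerivAt t h
  have him0 : d.im = 0 := by
    have e : (fun t => (Y (arc t)).im) = fun _ => (0 : ℝ) := by
      funext t; exact Y_im_eq_zero (arc_im_pos t) (norm_arc t)
    rw [e] at him
    exact him.unique (hasDerivAt_const t 0)
  refine ⟨d.re, fun h0 => hd0 (Complex.ext h0 him0), hre⟩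

lemma continuous_arcY : Continuous arcY :=
  continuous_iff_continuousAt.2 fun t => (hasDerivAt_arcY t).choose_spec.2.continuousAt

lemma arcY_injective : Function.Injective arcY := by
  have key : ∀ s t : ℝ, s < t → arcY s ≠ arcY t := by
    intro s t hst h
    choose c hc hd using hasDerivAt_arcY
    obtain ⟨x, -, hx⟩ := exists_hasDerivAt_eq_zero hst continuous_arcY.continuousOn h
      fun x _ => hd x
    exact hc x hx
  intro s t h
  rcases lt_trichotomy s t with hst | hst | hst
  · exact absurd h (key s t hst)
  · exact hst
  · exact absurd h.symm (key t s hst)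

lemma exists_le_abs_arcY (X : ℝ) : ∃ t, X ≤ |arcY t| := by
  obtain ⟨H, hH, hlam⟩ := exists_norm_lam_lt (ε := 1 / (|X| + 2)) (by positivity)
  refine ⟨Real.log (2 * H), ?_⟩
  set w : ℂ := (1 + I * Real.exp (Real.log (2 * H))) / 2 with hw
  have hwim : w.im = H := by
    rw [hw, Real.exp_log (by positivity)]; simp
  have hw0 : 0 < w.im := hwim ▸ hH
  have e : arc (Real.log (2 * H)) = -1 / w + 1 := by
    have := arc_den_ne_zero (Real.log (2 * H))
    rw [arc, hw]; field_simp; ring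
  have hl := hlam w hwim.ge
  have hl0 := lam_ne_zero hw0
  have e2 : lam (arc (Real.log (2 * H))) = 1 - 1 / lam w := by
    rw [e, lam_add_one (im_neg_one_div_pos hw0), lam_neg_one_div hw0,
      show 1 - lam w - 1 = -lam w by ring]
    field_simp
    ring
  have h3 : |arcY (Real.log (2 * H))| = ‖1 / lam w - 1 / 2‖ := by
    rw [← Real.norm_eq_abs, ← Complex.norm_real, arcY_eq, Y, e2, norm_mul, norm_neg, norm_I, one_mul,
      ← norm_neg]
    congr 1; ring
  rw [h3]
  have h4 : |X| + 2 ≤ ‖1 / lam w‖ := by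
    rw [norm_div, norm_one]
    have := one_div_le_one_div_of_le (norm_pos_iff.2 hl0) hl.le
    simpa using this
  have h5 := norm_sub_norm_le (1 / lam w) (1 / 2)
  have h6 : ‖(1 / 2 : ℂ)‖ = 1 / 2 := by norm_num
  have := le_abs_self X
  linarith

lemma arcY_surjective : Function.Surjective arcY := by
  intro x
  obtain ⟨t, ht⟩ := exists_le_abs_arcY |x|
  have hx := abs_le.1 ht
  rcases abs_cases (arcY t) with ⟨h, -⟩ | ⟨h, -⟩
  · rw [h] at hx
    exact mem_range_of_exists_le_of_exists_ge continuous_arcY ⟨-t, by rw [arcY_neg]; exact hx.1⟩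
      ⟨t, hx.2⟩
  · rw [h] at hx
    exact mem_range_of_exists_le_of_exists_ge continuous_arcY ⟨t, by linarith [hx.1]⟩
      ⟨-t, by rw [arcY_neg]; exact hx.2⟩

lemma continuous_inverse_of_bijective {j : ℝ → ℝ} (hc : Continuous j) (hi : Function.Injective j)
    (hs : Function.Surjective j) :
    ∃ k : ℝ → ℝ, Continuous k ∧ Function.LeftInverse k j ∧ Function.RightInverse k j := by
  rcases hc.strictMono_of_inj hi with h | h
  · let e := h.orderIsoOfSurjective j hs
    exact ⟨e.symm, e.symm.continuous, e.symm_apply_apply, e.apply_symm_apply⟩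
  · let e := h.neg.orderIsoOfSurjective (fun t => -j t) (fun x => by
      obtain ⟨t, ht⟩ := hs (-x)
      exact ⟨t, by simp [ht]⟩)
    refine ⟨fun x => e.symm (-x), e.symm.continuous.comp continuous_neg, fun t => ?_, fun x => ?_⟩
    · exact e.symm_apply_apply t
    · have : -j (e.symm (-x)) = -x := e.apply_symm_apply (-x)
      exact neg_inj.1 this

lemma exists_arc_inverse : ∃ φ : ℝ → ℂ, Continuous φ ∧ (∀ x, 0 < (φ x).im) ∧ (∀ x, ‖φ x‖ = 1) ∧
    (∀ x, Y (φ x) = x) ∧ (∀ τ : ℂ, 0 < τ.im → ‖τ‖ = 1 → φ (Y τ).re = τ) := by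
  obtain ⟨k, hk, hl, hr⟩ := continuous_inverse_of_bijective continuous_arcY arcY_injective
    arcY_surjective
  have hc : Continuous arc := continuous_iff_continuousAt.2 fun t => (hasDerivAt_arc t).continuousAt
  refine ⟨fun x => arc (k x), hc.comp hk, fun x => arc_im_pos _, fun x => norm_arc _, fun x => ?_, ?_⟩
  · rw [← arcY_eq, hr]
  · intro τ hτ h
    obtain ⟨t, rfl⟩ := exists_arc_eq hτ h
    exact congrArg arc (hl t)

/-- Push-forward of a holomorphic germ by `Y`. -/
lemma exists_germ {F : ℂ → ℂ} (hF : DifferentiableOn ℂ F upperHalf) {φ : ℝ → ℂ} (hφ : Continuous φ)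
    (hφim : ∀ x, 0 < (φ x).im) (hφY : ∀ x, Y (φ x) = x) (x₀ : ℝ) :
    ∃ g : ℂ → ℂ, AnalyticAt ℂ g x₀ ∧ (∀ᶠ x : ℝ in 𝓝 x₀, g x = F (φ x)) ∧
      ∀ᶠ σ in 𝓝 (φ x₀), g (Y σ) = F σ := by
  have him := hφim x₀
  have hYan : AnalyticAt ℂ Y (φ x₀) :=
    differentiableOn_Y.analyticAt (upperHalf_mem_nhds him)
  have hFan : AnalyticAt ℂ F (φ x₀) := hF.analyticAt (upperHalf_mem_nhds him)
  have hs : HasStrictDerivAt Y (deriv Y (φ x₀)) (φ x₀) := hYan.hasStrictDerivAt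
  set ψ := hs.localInverse Y _ _ (deriv_Y_ne_zero him) with hψ
  have hleft : ∀ᶠ σ in 𝓝 (φ x₀), ψ (Y σ) = σ := hs.eventually_left_inverse (deriv_Y_ne_zero him)
  have hψx : ψ x₀ = φ x₀ := by rw [← hφY]; exact hleft.self_of_nhds
  have hψan : AnalyticAt ℂ ψ x₀ := by
    rw [← hφY]; exact hYan.analyticAt_localInverse (deriv_Y_ne_zero him)
  refine ⟨F ∘ ψ, ?_, ?_, ?_⟩
  · exact AnalyticAt.comp (by rwa [hψx]) hψan
  · filter_upwards [hφ.continuousAt.eventually hleft] with x hx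
    rw [Function.comp_apply, ← hφY, hx]
  · filter_upwards [hleft] with σ hσ
    rw [Function.comp_apply, hσ]

end HyperbolicFourier

namespace HyperbolicFourier

open Complex Topology MeasureTheory

/-- Integrals of holomorphic functions depending on a parameter, dominated by an integrable
function, are holomorphic. -/
lemma differentiableOn_integral {α : Type*} [MeasurableSpace α] {μ : Measure α} {k : α → ℂ → ℂ}
    {U : Set ℂ} {b : α → ℝ} (hU : IsOpen U) (hk : ∀ᵐ x ∂μ, DifferentiableOn ℂ (k x) U)
    (hmeas : ∀ w ∈ U, AEStronglyMeasurable (fun x => k x w) μ)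
    (hbound : ∀ᵐ x ∂μ, ∀ w ∈ U, ‖k x w‖ ≤ b x) (hb : Integrable b μ) :
    DifferentiableOn ℂ (fun w => ∫ x, k x w ∂μ) U := by
  intro w₀ hw₀
  refine DifferentiableAt.differentiableWithinAt ?_
  obtain ⟨r, hr, hball⟩ := Metric.isOpen_iff.1 hU w₀ hw₀
  have hr2 : 0 < r / 2 := by positivity
  have hsub : ∀ w ∈ Metric.ball w₀ (r / 2), Metric.closedBall w (r / 4) ⊆ U := by
    intro w hw z hz
    apply hball
    rw [Metric.mem_ball] at hw ⊢
    rw [Metric.mem_closedBall] at hz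
    linarith [dist_triangle z w w₀]
  have hderiv : ∀ᵐ x ∂μ, ∀ w ∈ Metric.ball w₀ (r / 2), HasDerivAt (k x) (deriv (k x) w) w := by
    filter_upwards [hk] with x hx w hw
    exact (hx.differentiableAt (hU.mem_nhds (hsub w hw (Metric.mem_closedBall_self
      (by positivity))))).hasDerivAt
  refine (hasDerivAt_integral_of_dominated_loc_of_deriv_le (F := fun w x => k x w)
    (F' := fun w x => deriv (k x) w) (bound := fun x => b x / (r / 4))
    (Metric.ball_mem_nhds w₀ hr2) ?_ ?_ ?_ ?_ (hb.div_const _) hderiv).2.differentiableAt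
  · filter_upwards [hU.mem_nhds hw₀] with w hw using hmeas w hw
  · exact hb.mono' (hmeas w₀ hw₀) (hbound.mono fun x hx => hx w₀ hw₀)
  · have hlim : Tendsto (fun n : ℕ => w₀ + ((r / 4 / (n + 1) : ℝ) : ℂ)) atTop (𝓝[≠] w₀) := by
      refine tendsto_nhdsWithin_iff.2 ⟨?_, Eventually.of_forall fun n => ?_⟩
      · have h1 : Tendsto (fun n : ℕ => r / 4 / ((n : ℝ) + 1)) atTop (𝓝 0) :=
          tendsto_const_nhds.div_atTop (tendsto_natCast_atTop_atTop.atTop_add tendsto_const_nhds)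
        have h2 := (continuous_ofReal.tendsto 0).comp h1
        simpa [Function.comp_def] using h2.const_add w₀
      · have : r / 4 / ((n : ℝ) + 1) ≠ 0 := by positivity
        simpa [-ofReal_div, -ofReal_add, ofReal_eq_zero] using this
    have hmem : ∀ n : ℕ, w₀ + ((r / 4 / (n + 1) : ℝ) : ℂ) ∈ U := by
      intro n
      refine hsub w₀ (Metric.mem_ball_self hr2) ?_
      rw [mem_closedBall_iff_norm, add_sub_cancel_left, Complex.norm_real, Real.norm_of_nonneg
        (by positivity)]
      exact div_le_self (by positivity) (by linarith [Nat.cast_nonneg (α := ℝ) n])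
    refine aestronglyMeasurable_of_tendsto_ae atTop
      (f := fun (n : ℕ) x => slope (k x) w₀ (w₀ + ((r / 4 / (n + 1) : ℝ) : ℂ))) (fun n => ?_) ?_
    · simp only [slope_def_field]
      exact ((hmeas _ (hmem n)).sub (hmeas w₀ hw₀)).mul_const
        (w₀ + ((r / 4 / (n + 1) : ℝ) : ℂ) - w₀)⁻¹
    · filter_upwards [hderiv] with x hx
      exact (hasDerivAt_iff_tendsto_slope.1 (hx w₀ (Metric.mem_ball_self hr2))).comp hlim
  · filter_upwards [hk, hbound] with x hx hbx w hw
    have hs := hsub w hw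
    refine norm_deriv_le_of_forall_mem_sphere_norm_le (by positivity) ?_ fun z hz =>
      hbx z (hs (Metric.sphere_subset_closedBall hz))
    exact (hx.mono ((Metric.closure_ball_subset_closedBall).trans hs)).diffContOnCl

/-- A Weierstrass-type convergence factor: a kernel reproducing `f₀` on the diagonal, entire in the
second variable, and decaying in the first one. -/
lemma exists_entire_kernel {f₀ : ℝ → ℂ} (hf₀ : Continuous f₀) :
    ∃ h : ℝ → ℂ → ℂ, (∀ x, Differentiable ℂ (h x)) ∧ (∀ w, Measurable fun x => h x w) ∧
      (∀ x, h x x = f₀ x) ∧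
      ∀ R : ℝ, ∃ C : ℝ, ∀ w : ℂ, ‖w‖ ≤ R → ∀ x, ‖h x w‖ ≤ C * (1 + x ^ 2)⁻¹ := by
  classical
  set N : ℝ → ℕ := fun x => if |x| < 1 then 0 else ⌈‖f₀ x‖ * (1 + x ^ 2)⌉₊ with hN
  have hNm : Measurable N := by
    refine Measurable.ite (measurableSet_lt measurable_norm measurable_const) measurable_const ?_
    exact Nat.measurable_ceil.comp (by fun_prop)
  have hNle : ∀ x, (N x : ℝ) ≤ ‖f₀ x‖ * (1 + x ^ 2) + 1 := by
    intro x
    simp only [hN]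
    split_ifs
    · simp; positivity
    · exact (Nat.ceil_lt_add_one (by positivity)).le
  refine ⟨fun x w => f₀ x * (w / x) ^ N x, fun x => by fun_prop, fun w => ?_, fun x => ?_,
    fun R => ?_⟩
  · refine hf₀.measurable.mul ?_
    exact Measurable.pow (by fun_prop) hNm
  · rcases eq_or_ne x 0 with rfl | hx
    · simp [hN]
    · beta_reduce
      rw [div_self (by exact_mod_cast hx), one_pow, mul_one]
  · set L := 2 * |R| + 1 with hL
    obtain ⟨M, hM⟩ := (isCompact_Icc (a := -L) (b := L)).exists_bound_of_continuousOn
      hf₀.continuousOn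
    set n₀ : ℕ := ⌈M * (1 + L ^ 2) + 1⌉₊ with hn₀
    have hM0 : 0 ≤ M := (norm_nonneg _).trans (hM 0 ⟨by linarith [abs_nonneg R], by positivity⟩)
    refine ⟨max 1 (M * (|R| + 1) ^ n₀ * (1 + L ^ 2)), fun w hw x => ?_⟩
    have hw' : ‖w‖ ≤ |R| := hw.trans (le_abs_self R)
    rw [norm_mul, norm_pow, norm_div, Complex.norm_real, Real.norm_eq_abs]
    have hpos : 0 < 1 + x ^ 2 := by positivity
    rw [← div_eq_mul_inv, le_div_iff₀ hpos]
    rcases le_or_gt |x| L with hx | hx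
    · refine le_max_of_le_right ?_
      have hx2 : x ^ 2 ≤ L ^ 2 := sq_le_sq.2 (hx.trans (le_abs_self L))
      have hfM := hM x (abs_le.1 hx)
      have hpow : (‖w‖ / |x|) ^ N x ≤ (|R| + 1) ^ n₀ := by
        by_cases h1 : |x| < 1
        · have : N x = 0 := by simp [hN, h1]
          rw [this, pow_zero]
          exact one_le_pow₀ (by linarith [abs_nonneg R])
        · push Not at h1
          have hNn : N x ≤ n₀ := by
            have : (N x : ℝ) ≤ n₀ := by
              refine (hNle x).trans (le_trans ?_ (Nat.le_ceil _))
              gcongr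
            exact_mod_cast this
          calc (‖w‖ / |x|) ^ N x ≤ (|R| + 1) ^ N x := by
                gcongr
                exact (div_le_self (norm_nonneg _) h1).trans (by linarith)
            _ ≤ _ := pow_le_pow_right₀ (by linarith [abs_nonneg R]) hNn
      gcongr
    · refine le_max_of_le_left ?_
      have h1 : 1 ≤ |x| := by linarith [abs_nonneg R]
      have hNx : N x = ⌈‖f₀ x‖ * (1 + x ^ 2)⌉₊ := by simp [hN, h1]
      have hhalf : ‖w‖ / |x| ≤ 1 / 2 := by
        rw [div_le_iff₀ (by linarith)]
        linarith
      have h2 : ‖f₀ x‖ * (1 + x ^ 2) ≤ 2 ^ N x := by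
        refine (Nat.le_ceil _).trans ?_
        rw [← hNx]
        exact_mod_cast (Nat.lt_two_pow_self).le
      calc ‖f₀ x‖ * (‖w‖ / |x|) ^ N x * (1 + x ^ 2)
          = ‖f₀ x‖ * (1 + x ^ 2) * (‖w‖ / |x|) ^ N x := by ring
        _ ≤ 2 ^ N x * (1 / 2) ^ N x := by gcongr
        _ = 1 := by rw [← mul_pow]; norm_num

lemma aestronglyMeasurable_cauchy {h : ℝ → ℂ → ℂ} (hm : ∀ w, Measurable fun x => h x w)
    (μ : Measure ℝ) (w : ℂ) : AEStronglyMeasurable (fun x : ℝ => h x w / (x - w)) μ :=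
  ((hm w).div (by fun_prop)).aestronglyMeasurable

lemma differentiableOn_cauchy_integral {h : ℝ → ℂ → ℂ} (hd : ∀ x, Differentiable ℂ (h x))
    (hm : ∀ w, Measurable fun x => h x w) {C d : ℝ} (hd0 : 0 < d) {U : Set ℂ} (hU : IsOpen U)
    {S : Set ℝ} (hS : MeasurableSet S)
    (hC : ∀ w ∈ U, ∀ x, ‖h x w‖ ≤ C * (1 + x ^ 2)⁻¹)
    (hdist : ∀ x ∈ S, ∀ w ∈ U, d ≤ ‖x - w‖) :
    DifferentiableOn ℂ (fun w => ∫ x in S, h x w / (x - w)) U ∧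
      ∀ w ∈ U, IntegrableOn (fun x : ℝ => h x w / (x - w)) S := by
  have hb : IntegrableOn (fun x : ℝ => C * (1 + x ^ 2)⁻¹ / d) S :=
    ((integrable_inv_one_add_sq.const_mul C).div_const d).integrableOn
  have hbound : ∀ᵐ x ∂volume.restrict S, ∀ w ∈ U, ‖h x w / (x - w)‖ ≤ C * (1 + x ^ 2)⁻¹ / d := by
    filter_upwards [ae_restrict_mem hS] with x hx w hw
    rw [norm_div]
    have := hC w hw x
    have h0 := (norm_nonneg _).trans this
    exact div_le_div₀ h0 this hd0 (hdist x hx w hw)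
  refine ⟨differentiableOn_integral hU ?_ (fun w _ => aestronglyMeasurable_cauchy hm _ w) hbound hb,
    fun w hw => hb.mono' (aestronglyMeasurable_cauchy hm _ w) (hbound.mono fun x hx => hx w hw)⟩
  filter_upwards [ae_restrict_mem hS] with x hx
  refine (hd x).differentiableOn.div (differentiableOn_id.const_sub _) fun w hw h0 => ?_
  have := hdist x hx w hw
  rw [show (x : ℂ) - w = 0 from h0, norm_zero] at this
  linarith

lemma integral_one_div_sub {w : ℂ} (hw : w.im ≠ 0) (a b : ℝ) :
    ∫ x in a..b, 1 / ((x : ℂ) - w) = log (b - w) - log (a - w) := by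
  have hslit : ∀ x : ℝ, (x : ℂ) - w ∈ slitPlane := fun x => by
    right; simpa using hw
  refine intervalIntegral.integral_eq_sub_of_hasDerivAt (f := fun x : ℝ => log ((x : ℂ) - w))
    (fun x _ => ?_) ?_
  · have h1 : HasDerivAt (fun x : ℝ => (x : ℂ) - w) 1 x := (hasDerivAt_id x).ofReal_comp.sub_const w
    exact h1.clog_real (hslit x)
  · refine Continuous.intervalIntegrable ?_ _ _
    exact continuous_const.div (by fun_prop) fun x => slitPlane_ne_zero (hslit x)

lemma log_neg_of_im_pos {z : ℂ} (hz : 0 < z.im) : log (-z) = log z - Real.pi * I := by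
  apply Complex.ext <;> simp [log_re, log_im, arg_neg_eq_arg_sub_pi_of_im_pos hz]

lemma log_neg_of_im_neg {z : ℂ} (hz : z.im < 0) : log (-z) = log z + Real.pi * I := by
  apply Complex.ext <;> simp [log_re, log_im, arg_neg_eq_arg_add_pi_of_im_neg hz]

lemma differentiableOn_integral_dslope {h : ℝ → ℂ → ℂ} (hd : ∀ x, Differentiable ℂ (h x))
    (hm : ∀ w, Measurable fun x => h x w) {g : ℂ → ℂ} {x₀ δ M : ℝ} (hδ : 0 < δ)
    (hg : DifferentiableOn ℂ g (Metric.ball x₀ (3 * δ)))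
    (hM : ∀ x ∈ Set.Ioo (x₀ - δ) (x₀ + δ), ∀ w ∈ Metric.ball (x₀ : ℂ) (3 * δ), ‖h x w - g w‖ ≤ M)
    (hgh : ∀ x ∈ Set.Ioo (x₀ - δ) (x₀ + δ), h x x = g x) :
    DifferentiableOn ℂ
      (fun w => ∫ x in Set.Ioo (x₀ - δ) (x₀ + δ), -dslope (fun w => h x w - g w) x w)
      (Metric.ball x₀ δ) := by
  have hxball : ∀ x ∈ Set.Ioo (x₀ - δ) (x₀ + δ), ‖(x : ℂ) - x₀‖ < δ := by
    intro x hx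
    rw [← ofReal_sub, Complex.norm_real, Real.norm_eq_abs, abs_lt]
    constructor <;> linarith [hx.1, hx.2]
  have hsub : ∀ x ∈ Set.Ioo (x₀ - δ) (x₀ + δ),
      Metric.ball (x : ℂ) (2 * δ) ⊆ Metric.ball (x₀ : ℂ) (3 * δ) := by
    intro x hx
    refine Metric.ball_subset_ball' ?_
    rw [dist_eq]
    linarith [hxball x hx]
  have hsub' : ∀ x ∈ Set.Ioo (x₀ - δ) (x₀ + δ),
      Metric.ball (x₀ : ℂ) δ ⊆ Metric.ball (x : ℂ) (2 * δ) := by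
    intro x hx
    refine Metric.ball_subset_ball' ?_
    rw [dist_comm, dist_eq]
    linarith [hxball x hx]
  have hfd : ∀ x ∈ Set.Ioo (x₀ - δ) (x₀ + δ),
      DifferentiableOn ℂ (fun w => h x w - g w) (Metric.ball (x : ℂ) (2 * δ)) := fun x hx =>
    (hd x).differentiableOn.sub (hg.mono (hsub x hx))
  refine differentiableOn_integral (b := fun _ => M / (2 * δ)) Metric.isOpen_ball ?_ ?_ ?_ ?_
  · filter_upwards [ae_restrict_mem measurableSet_Ioo] with x hx
    refine ((differentiableOn_dslope ?_).2 (hfd x hx)).neg.mono (hsub' x hx)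
    exact Metric.ball_mem_nhds _ (by positivity)
  · intro w hw
    have : AEStronglyMeasurable (fun x : ℝ => (h x w - g w) / (x - w))
        (volume.restrict (Set.Ioo (x₀ - δ) (x₀ + δ))) :=
      (((hm w).sub_const _).div (by fun_prop)).aestronglyMeasurable
    refine this.congr ?_
    have hne : ∀ᵐ x : ℝ ∂volume.restrict (Set.Ioo (x₀ - δ) (x₀ + δ)), x ≠ w.re :=
      ae_restrict_of_ae (by simp [ae_iff])
    filter_upwards [ae_restrict_mem measurableSet_Ioo, hne] with x hx hxw
    have hne' : w ≠ x := fun h => hxw (by simp [h])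
    rw [dslope_of_ne _ hne', slope_def_field, hgh x hx, sub_self, sub_zero, ← div_neg, neg_sub]
  · filter_upwards [ae_restrict_mem measurableSet_Ioo] with x hx w hw
    rw [norm_neg]
    refine norm_dslope_le_div_of_mapsTo_ball (hfd x hx) (fun z hz => ?_) (hsub' x hx hw)
    rw [mem_closedBall_iff_norm, hgh x hx, sub_self, sub_zero]
    exact hM x hx z (hsub x hx hz)
  · exact integrableOn_const (by simp)

/-- The Cauchy transform of a real-analytic function has analytic boundary values on both sides,
whose difference is the given function. -/
lemma exists_cauchy_transform {f₀ : ℝ → ℂ} (hf₀ : Continuous f₀) {g : ℝ → ℂ → ℂ}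
    (hg : ∀ x₀, AnalyticAt ℂ (g x₀) x₀) (hgf : ∀ x₀ : ℝ, ∀ᶠ x : ℝ in 𝓝 x₀, g x₀ x = f₀ x) :
    ∃ Φ : ℂ → ℂ, (∀ w, w.im ≠ 0 → DifferentiableAt ℂ Φ w) ∧
      ∀ x₀ : ℝ, ∃ P : ℂ → ℂ, AnalyticAt ℂ P x₀ ∧ ∀ᶠ w in 𝓝 (x₀ : ℂ),
        (0 < w.im → Φ w = P w) ∧ (w.im < 0 → Φ w = P w - g x₀ w) := by
  obtain ⟨h, hd, hm, hdiag, hdecay⟩ := exists_entire_kernel hf₀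
  have hpi : (2 * Real.pi * I : ℂ) ≠ 0 := two_pi_I_ne_zero
  have hoff : ∀ w : ℂ, w.im ≠ 0 → DifferentiableAt ℂ (fun w => ∫ x : ℝ, h x w / (x - w)) w ∧
      Integrable (fun x : ℝ => h x w / (x - w)) := by
    intro w hw
    have hw' : 0 < |w.im| / 2 := by positivity
    obtain ⟨C, hC⟩ := hdecay (‖w‖ + |w.im| / 2)
    have := differentiableOn_cauchy_integral hd hm hw' (U := Metric.ball w (|w.im| / 2))
      Metric.isOpen_ball MeasurableSet.univ (C := C) (fun z hz => hC z ?_) (fun x _ z hz => ?_)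
    · simp only [Measure.restrict_univ, integrableOn_univ] at this
      exact ⟨this.1.differentiableAt (Metric.ball_mem_nhds _ hw'),
        this.2 w (Metric.mem_ball_self hw')⟩
    · rw [mem_ball_iff_norm] at hz
      have := norm_sub_norm_le z w
      linarith
    · rw [mem_ball_iff_norm] at hz
      have h1 := abs_im_le_norm (z - w)
      have h2 := abs_im_le_norm (x - z)
      simp only [sub_im, ofReal_im, zero_sub, abs_neg] at h1 h2
      have h3 := abs_sub_abs_le_abs_sub w.im z.im
      rw [abs_sub_comm] at h3
      linarith
  refine ⟨fun w => (2 * Real.pi * I)⁻¹ * ∫ x : ℝ, h x w / (x - w),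
    fun w hw => (hoff w hw).1.const_mul _, fun x₀ => ?_⟩
  obtain ⟨r₁, hr₁, hgd⟩ := Metric.eventually_nhds_iff_ball.1 (hg x₀).eventually_analyticAt
  obtain ⟨r₂, hr₂, hgf₂⟩ := Metric.eventually_nhds_iff_ball.1 (hgf x₀)
  obtain ⟨r₃, hr₃, hgb⟩ := Metric.eventually_nhds_iff_ball.1
    ((hg x₀).continuousAt.norm.eventually_lt_const (lt_add_one _))
  set δ := min r₁ (min r₂ r₃) / 3 with hδdef
  have hδ : 0 < δ := by positivity
  have h3δ : 3 * δ = min r₁ (min r₂ r₃) := by rw [hδdef]; ring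
  set J := Set.Ioo (x₀ - δ) (x₀ + δ) with hJ
  have hgd' : DifferentiableOn ℂ (g x₀) (Metric.ball x₀ (3 * δ)) := fun z hz =>
    (hgd z (Metric.ball_subset_ball (h3δ.le.trans (min_le_left _ _)) hz)).differentiableAt.differentiableWithinAt
  obtain ⟨C, hC⟩ := hdecay (|x₀| + 3 * δ)
  have hnorm : ∀ w ∈ Metric.ball (x₀ : ℂ) (3 * δ), ‖w‖ ≤ |x₀| + 3 * δ := by
    intro w hw
    rw [mem_ball_iff_norm] at hw
    have := norm_sub_norm_le w x₀
    rw [Complex.norm_real, Real.norm_eq_abs] at this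
    linarith
  have hC0 : 0 ≤ C := by
    have := (norm_nonneg _).trans (hC 0 (by simp; positivity) 0)
    simpa using this
  have hgx : ∀ x ∈ J, h x x = g x₀ x := by
    intro x hx
    rw [hdiag, hgf₂ x]
    rw [Real.ball_eq_Ioo]
    have : 3 * δ ≤ r₂ := h3δ.le.trans ((min_le_right _ _).trans (min_le_left _ _))
    exact ⟨by linarith [hx.1], by linarith [hx.2]⟩
  have hnear := differentiableOn_integral_dslope hd hm hδ hgd' (M := C + (‖g x₀ x₀‖ + 1))
    (fun x hx w hw => by
      refine (norm_sub_le _ _).trans (add_le_add ((hC w (hnorm w hw) x).trans ?_) ?_)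
      · exact mul_le_of_le_one_right hC0 (inv_le_one_of_one_le₀ (by nlinarith))
      · exact (hgb w (Metric.ball_subset_ball
          (h3δ.le.trans ((min_le_right _ _).trans (min_le_right _ _))) hw)).le)
    hgx
  rw [← hJ] at hnear
  have hfar := differentiableOn_cauchy_integral hd hm (half_pos hδ)
    (U := Metric.ball (x₀ : ℂ) (δ / 2)) Metric.isOpen_ball (S := Jᶜ) measurableSet_Ioo.compl
    (fun w hw => hC w (hnorm w (Metric.ball_subset_ball (by linarith) hw)))
    (fun x hx w hw => by
      rw [mem_ball_iff_norm] at hw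
      have h1 : δ ≤ ‖(x : ℂ) - x₀‖ := by
        rw [← ofReal_sub, Complex.norm_real, Real.norm_eq_abs]
        by_contra! hlt
        rw [abs_lt] at hlt
        exact hx ⟨by linarith [hlt.1], by linarith [hlt.2]⟩
      have h2 : (x : ℂ) - x₀ = (x - w) + (w - x₀) := by ring
      have h3 := norm_add_le ((x : ℂ) - w) (w - x₀)
      rw [← h2] at h3
      linarith)
  have hball : Metric.ball (x₀ : ℂ) (δ / 2) ∈ 𝓝 (x₀ : ℂ) := Metric.ball_mem_nhds _ (half_pos hδ)
  have hlog : DifferentiableOn ℂ (fun w : ℂ => log ((x₀ + δ : ℝ) - w) - log (w - (x₀ - δ : ℝ)))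
      (Metric.ball (x₀ : ℂ) (δ / 2)) := by
    intro w hw
    rw [mem_ball_iff_norm] at hw
    have h1 := (abs_re_le_norm (w - x₀)).trans_lt hw
    simp only [sub_re, ofReal_re, abs_lt] at h1
    refine DifferentiableAt.differentiableWithinAt (DifferentiableAt.sub ?_ ?_)
    · exact (differentiableAt_id.const_sub _).clog (Or.inl (by simp; linarith))
    · exact (differentiableAt_id.sub_const _).clog (Or.inl (by simp; linarith))
  set P : ℂ → ℂ := fun w => (2 * Real.pi * I)⁻¹ * ((∫ x in Jᶜ, h x w / (x - w)) +
    (∫ x in J, -dslope (fun w => h x w - g x₀ w) x w) +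
    g x₀ w * (log ((x₀ + δ : ℝ) - w) - log (w - (x₀ - δ : ℝ)) + Real.pi * I)) with hP
  have hPd : DifferentiableOn ℂ P (Metric.ball (x₀ : ℂ) (δ / 2)) :=
    ((hfar.1.add (hnear.mono (Metric.ball_subset_ball (by linarith)))).add
      ((hgd'.mono (Metric.ball_subset_ball (by linarith))).mul (hlog.add_const _))).const_mul _
  refine ⟨P, hPd.analyticAt hball, ?_⟩
  have hmain : ∀ w : ℂ, w.im ≠ 0 → ∫ x : ℝ, h x w / (x - w) =
      (∫ x in Jᶜ, h x w / (x - w)) + (∫ x in J, -dslope (fun w => h x w - g x₀ w) x w) +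
      g x₀ w * (log ((x₀ + δ : ℝ) - w) - log ((x₀ - δ : ℝ) - w)) := by
    intro w hw
    have hint := (hoff w hw).2
    have hne : ∀ x : ℝ, (x : ℂ) - w ≠ 0 := fun x h0 => hw (by simpa using congrArg im h0)
    have hint2 : IntegrableOn (fun x : ℝ => g x₀ w * (1 / ((x : ℂ) - w))) J := by
      refine IntegrableOn.mono_set ?_ (Set.Ioo_subset_Icc_self)
      refine ContinuousOn.integrableOn_Icc (Continuous.continuousOn ?_)
      exact continuous_const.mul (continuous_const.div (by fun_prop) hne)
    have hpt : ∀ x ∈ J, h x w / (x - w) - g x₀ w * (1 / ((x : ℂ) - w)) =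
        -dslope (fun w => h x w - g x₀ w) x w := by
      intro x hx
      have hne' : w ≠ x := fun h0 => hne x (by rw [h0, sub_self])
      rw [dslope_of_ne _ hne', slope_def_field, hgx x hx, sub_self, sub_zero, ← div_neg, neg_sub]
      ring
    have hint3 : IntegrableOn (fun x : ℝ => -dslope (fun w => h x w - g x₀ w) x w) J :=
      (hint.integrableOn.sub hint2).congr_fun hpt measurableSet_Ioo
    rw [← integral_add_compl (measurableSet_Ioo : MeasurableSet J) hint, ← integral_one_div_sub hw,
      intervalIntegral.integral_of_le (by linarith), integral_Ioc_eq_integral_Ioo, ← hJ,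
      ← integral_const_mul, add_comm, add_assoc, ← integral_add hint3 hint2]
    congr 1
    refine setIntegral_congr_fun measurableSet_Ioo fun x hx => ?_
    rw [← hpt x hx]
    ring
  filter_upwards [hball] with w hw
  constructor
  · intro hwi
    have : log ((x₀ - δ : ℝ) - w) = log (w - (x₀ - δ : ℝ)) - Real.pi * I := by
      rw [← log_neg_of_im_pos (by simpa using hwi), neg_sub]
    simp only [hP]
    rw [hmain w hwi.ne', this]
    ring
  · intro hwi
    have : log ((x₀ - δ : ℝ) - w) = log (w - (x₀ - δ : ℝ)) + Real.pi * I := by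
      rw [← log_neg_of_im_neg (by simpa using hwi), neg_sub]
    simp only [hP]
    rw [hmain w hwi.ne, this]
    field_simp
    ring

end HyperbolicFourier

namespace HyperbolicFourier

open Complex Topology

lemma nhdsWithin_im_pos_neBot (x : ℝ) : (𝓝[{w : ℂ | 0 < w.im}] (x : ℂ)).NeBot := by
  rw [← mem_closure_iff_nhdsWithin_neBot, closure_setOfPred_lt_im]
  simp

lemma exists_boundary_values {f₀ : ℝ → ℂ} (hf₀ : Continuous f₀) {g : ℝ → ℂ → ℂ}
    (hg : ∀ x₀ : ℝ, AnalyticAt ℂ (g x₀) x₀)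
    (hgf : ∀ x₀ : ℝ, ∀ᶠ x : ℝ in 𝓝 x₀, g x₀ x = f₀ x) :
    ∃ Φp Φm : ℂ → ℂ, (∀ w, 0 < w.im → DifferentiableAt ℂ Φp w) ∧
      (∀ w, w.im < 0 → DifferentiableAt ℂ Φm w) ∧
      ∀ x₀ : ℝ, ∃ P : ℂ → ℂ, AnalyticAt ℂ P x₀ ∧ ∀ᶠ w in 𝓝 (x₀ : ℂ),
        (0 ≤ w.im → Φp w = P w) ∧ (w.im ≤ 0 → Φm w = P w - g x₀ w) := by
  obtain ⟨Φ, hΦ, h⟩ := exists_cauchy_transform hf₀ hg hgf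
  choose P hP hPΦ using h
  have hlim : ∀ (Q : ℂ → ℂ) (x : ℝ), ContinuousAt Q x →
      (∀ᶠ w in 𝓝 (x : ℂ), 0 < w.im → Φ w = Q w) →
      Tendsto Φ (𝓝[{w : ℂ | 0 < w.im}] (x : ℂ)) (𝓝 (Q x)) := fun Q x hQ h =>
    (hQ.tendsto.mono_left nhdsWithin_le_nhds).congr' <| by
      filter_upwards [nhdsWithin_le_nhds h, self_mem_nhdsWithin] with w h1 h2 using (h1 h2).symm
  have hreal : ∀ x₀ : ℝ, ∀ᶠ x : ℝ in 𝓝 x₀, P x x = P x₀ x := by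
    intro x₀
    have h1 := (hP x₀).eventually_analyticAt.and (hPΦ x₀).eventually_nhds
    filter_upwards [continuous_ofReal.continuousAt.eventually h1] with x hx
    have := nhdsWithin_im_pos_neBot x
    exact tendsto_nhds_unique (hlim _ x (hP x).continuousAt ((hPΦ x).mono fun w h => h.1))
      (hlim _ x hx.1.continuousAt (hx.2.mono fun w h => h.1))
  refine ⟨fun w => if w.im = 0 then P w.re w.re else Φ w,
    fun w => if w.im = 0 then P w.re w.re - f₀ w.re else Φ w, ?_, ?_, fun x₀ => ⟨P x₀, hP x₀, ?_⟩⟩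
  · intro w hw
    refine (hΦ w hw.ne').congr_of_eventuallyEq ?_
    filter_upwards [continuous_im.continuousAt.eventually_ne hw.ne'] with z hz using if_neg hz
  · intro w hw
    refine (hΦ w hw.ne).congr_of_eventuallyEq ?_
    filter_upwards [continuous_im.continuousAt.eventually_ne hw.ne] with z hz using if_neg hz
  · have hre : Tendsto re (𝓝 (x₀ : ℂ)) (𝓝 x₀) := continuous_re.continuousAt.tendsto
    filter_upwards [hPΦ x₀, hre.eventually (hreal x₀), hre.eventually (hgf x₀)] with w h1 h2 h3
    by_cases h0 : w.im = 0
    · have hw : (w.re : ℂ) = w := Complex.ext rfl (by simp [h0])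
      rw [hw] at h2 h3
      simp [h0, hw, h2, h3]
    · simp only [h0, if_false]
      exact ⟨fun h => h1.1 (lt_of_le_of_ne h (Ne.symm h0)), fun h => h1.2 (lt_of_le_of_ne h h0)⟩

/-- The function `F` for `b = true` and its transform under `τ ↦ -1 / τ` for `b = false`. -/
def flip (F : ℂ → ℂ) (b : Bool) (τ : ℂ) : ℂ := if b then F τ else F (-1 / τ)

lemma differentiableAt_flip {F : ℂ → ℂ} (hF : DifferentiableOn ℂ F upperHalf) (b : Bool) {τ : ℂ}
    (hτ : 0 < τ.im) : DifferentiableAt ℂ (flip F b) τ := by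
  have h : ∀ {σ : ℂ}, 0 < σ.im → DifferentiableAt ℂ F σ := fun hσ =>
    hF.differentiableAt (upperHalf_mem_nhds hσ)
  cases b
  · exact (h (im_neg_one_div_pos hτ)).comp τ (differentiableAt_neg_one_div (ne_zero_of_im_pos hτ))
  · exact h hτ

/-- Functions on `{|red τ| ≥ 1}` whose extension across the unit circle by the functional equation
is holomorphic. -/
structure LocalSolution (F : ℂ → ℂ) (A : Bool → ℂ → ℂ) : Prop where
  periodic : ∀ b, Function.Periodic (A b) 2
  differentiableAt : ∀ b (τ : ℂ), 0 < τ.im → 1 < ‖red τ‖ → DifferentiableAt ℂ (A b) τ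
  continuation : ∀ b (τ₀ : ℂ), 0 < τ₀.im → ‖τ₀‖ = 1 → ∃ E : ℂ → ℂ, DifferentiableAt ℂ E τ₀ ∧
    ∀ᶠ σ in 𝓝 τ₀, (1 ≤ ‖σ‖ → A b σ = E σ) ∧ (‖σ‖ < 1 → flip F b σ - A (!b) (-1 / σ) = E σ)
  bounded : ∃ H C : ℝ, ∀ b (τ : ℂ), H ≤ τ.im → ‖A b τ‖ ≤ C

lemma eventually_one_le_norm_red {τ₀ : ℂ} (h0 : 0 < τ₀.im) (h1 : ‖τ₀‖ = 1) :
    ∀ᶠ σ in 𝓝 τ₀, 0 < σ.im ∧ (1 ≤ ‖σ‖ → 1 ≤ ‖red σ‖) ∧ (‖σ‖ < 1 → 1 < ‖red (-1 / σ)‖) := by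
  have hre : |τ₀.re| < 1 := by
    have := norm_sq_eq τ₀
    rw [h1] at this
    exact (sq_lt_one_iff_abs_lt_one _).1 (by nlinarith)
  have key : ∀ᶠ σ : ℂ in 𝓝 τ₀, 0 < σ.im ∧ |σ.re| < 1 :=
    (continuous_im.continuousAt.eventually_const_lt h0).and
      ((continuous_abs.comp continuous_re).continuousAt.eventually_lt_const hre)
  have hS : Tendsto (fun σ : ℂ => -1 / σ) (𝓝 τ₀) (𝓝 (-1 / τ₀)) :=
    (differentiableAt_neg_one_div (ne_zero_of_im_pos h0)).continuousAt.tendsto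
  have hre' : |(-1 / τ₀).re| < 1 := by
    rw [neg_one_div_of_norm_eq_one h1]; simpa using hre
  have key' := hS.eventually
    ((continuous_abs.comp continuous_re).continuousAt.eventually_lt_const hre')
  filter_upwards [key, key'] with σ hσ hσ'
  refine ⟨hσ.1, fun h => h.trans (norm_le_norm_red hσ.2.le), fun h => ?_⟩
  have h2 : 1 < ‖-1 / σ‖ := by
    rw [norm_div, norm_neg, norm_one]
    exact (one_lt_div (norm_pos_iff.2 (ne_zero_of_im_pos hσ.1))).2 h
  exact h2.trans_le (norm_le_norm_red (le_of_lt hσ'))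

lemma eventually_Y_im {τ₀ : ℂ} (h0 : 0 < τ₀.im) (h1 : ‖τ₀‖ = 1) :
    ∀ᶠ σ in 𝓝 τ₀, 0 < σ.im ∧ (1 ≤ ‖σ‖ → 0 ≤ (Y σ).im) ∧ (‖σ‖ < 1 → (Y σ).im < 0) := by
  filter_upwards [eventually_one_le_norm_red h0 h1] with σ ⟨hσ, hσ1, hσ2⟩
  refine ⟨hσ, fun h => Y_im_nonneg hσ (hσ1 h), fun h => ?_⟩
  have := Y_im_pos (im_neg_one_div_pos hσ) (hσ2 h)
  rw [Y_neg_one_div hσ, neg_im] at this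
  linarith

lemma tendsto_Y : Tendsto Y (comap im atTop) (𝓝 (I / 2)) := by
  have := (tendsto_lam.sub_const (1 / 2)).const_mul (-I)
  refine this.congr' (Eventually.of_forall fun _ => rfl) |>.trans_eq ?_
  congr 1; ring

theorem exists_localSolution {F : ℂ → ℂ} (hF : DifferentiableOn ℂ F upperHalf) :
    ∃ A, LocalSolution F A := by
  obtain ⟨φ, hφ, hφim, hφn, hφY, hφinv⟩ := exists_arc_inverse
  choose g hg hgφ hgF using exists_germ hF hφ hφim hφY
  obtain ⟨Φp, Φm, hp, hm, hb⟩ := exists_boundary_values (f₀ := fun x => F (φ x))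
    (hF.continuousOn.comp_continuous hφ hφim) hg hgφ
  have hY1 : ∀ {τ₀ : ℂ}, 0 < τ₀.im → ‖τ₀‖ = 1 → (((Y τ₀).re : ℝ) : ℂ) = Y τ₀ := fun h0 h1 =>
    Complex.ext rfl (by simp [Y_im_eq_zero h0 h1])
  refine ⟨fun b τ => if b then Φp (Y τ) else -Φm (-Y τ), ?_, ?_, ?_, ?_⟩
  · intro b τ
    simp only [Y_add_two]
  · intro b τ hτ h1
    have hY := Y_im_pos hτ h1
    cases b
    · exact ((hm (-Y τ) (by simpa using hY)).comp τ (differentiableAt_Y hτ).neg).neg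
    · exact (hp _ hY).comp τ (differentiableAt_Y hτ)
  · intro b τ₀ h0 h1
    have hY := hY1 h0 h1
    have hYt : Tendsto Y (𝓝 τ₀) (𝓝 (Y τ₀)) := (differentiableAt_Y h0).continuousAt.tendsto
    cases b
    · have h0' := im_neg_one_div_pos h0
      have h1' : ‖-1 / τ₀‖ = 1 := by rw [norm_div, norm_neg, norm_one, h1, div_one]
      have hS : Tendsto (fun σ : ℂ => -1 / σ) (𝓝 τ₀) (𝓝 (-1 / τ₀)) :=
        (differentiableAt_neg_one_div (ne_zero_of_im_pos h0)).continuousAt.tendsto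
      have hY' := hY1 h0' h1'
      have hx := Y_neg_one_div h0
      have hφ' := hφinv _ h0' h1'
      set x := (Y (-1 / τ₀)).re
      obtain ⟨P, hP, hPe⟩ := hb x
      have hYm : Tendsto (fun σ => -Y σ) (𝓝 τ₀) (𝓝 (x : ℂ)) := by
        rw [hY', hx]; exact hYt.neg
      have hgF' := hgF x
      rw [hφ'] at hgF'
      refine ⟨fun σ => -(P (-Y σ) - g x (-Y σ)), ?_, ?_⟩
      · have h2 : DifferentiableAt ℂ (fun w => P w - g x w) (-Y τ₀) := by
          rw [← hx, ← hY']
          exact hP.differentiableAt.sub (hg x).differentiableAt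
        exact (h2.comp τ₀ (differentiableAt_Y h0).neg).neg
      · filter_upwards [eventually_Y_im h0 h1, hYm.eventually hPe, hS.eventually hgF'] with σ h2 h3 h4
        refine ⟨fun h => ?_, fun h => ?_⟩
        · have := h3.2 (by simpa using h2.2.1 h)
          simp [this]
        · have := h3.1 (by simpa using (h2.2.2 h).le)
          rw [Y_neg_one_div h2.1] at h4
          simp [flip, Y_neg_one_div h2.1, this, h4]
    · have hφ' := hφinv _ h0 h1
      set x := (Y τ₀).re
      obtain ⟨P, hP, hPe⟩ := hb x
      have hgF' := hgF x
      rw [hφ'] at hgF'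
      refine ⟨fun σ => P (Y σ), ?_, ?_⟩
      · rw [hY] at hP
        exact hP.differentiableAt.comp τ₀ (differentiableAt_Y h0)
      · rw [hY] at hPe
        filter_upwards [eventually_Y_im h0 h1, hYt.eventually hPe, hgF'] with σ h2 h3 h4
        refine ⟨fun h => ?_, fun h => ?_⟩
        · simp [h3.1 (h2.2.1 h)]
        · have := h3.2 (h2.2.2 h).le
          simp [flip, Y_neg_one_div h2.1, this, h4]
  · have hpb : ∀ᶠ w in 𝓝 (I / 2), ‖Φp w‖ < ‖Φp (I / 2)‖ + 1 :=
      (hp _ (by simp)).continuousAt.norm.eventually_lt_const (by linarith)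
    have hmb : ∀ᶠ w in 𝓝 (-(I / 2)), ‖Φm w‖ < ‖Φm (-(I / 2))‖ + 1 :=
      (hm _ (by simp)).continuousAt.norm.eventually_lt_const (by linarith)
    obtain ⟨H, -, hH⟩ := eventually_comap_im
      ((tendsto_Y.eventually hpb).and (tendsto_Y.neg.eventually hmb))
    refine ⟨H, max (‖Φp (I / 2)‖ + 1) (‖Φm (-(I / 2))‖ + 1), fun b τ hτ => ?_⟩
    cases b
    · simpa using Or.inr (hH τ hτ).2.le
    · simpa using Or.inl (hH τ hτ).1.le

/-- One step `τ ↦ -1 / red τ` of the reduction towards `{|red τ| ≥ 1}`. -/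
def Step (σ τ : ℂ) : Prop := (0 < τ.im ∧ ‖red τ‖ < 1) ∧ σ = -1 / red τ

lemma red_eq_sub (τ : ℂ) : ∃ n : ℤ, red τ = τ - 2 * n := ⟨_, rfl⟩

lemma sq_lt_of_sq_lt {u x y : ℝ} (hu : 2 ≤ u) (h : (1 - u * x) ^ 2 + u ^ 2 * y ^ 2 < x ^ 2 + y ^ 2)
    (hx : x < 1) : x ^ 2 + 2 * y ^ 2 < 1 := by
  have h3 : 3 * y ^ 2 < x ^ 2 - (1 - u * x) ^ 2 := by
    have : 4 * y ^ 2 ≤ u ^ 2 * y ^ 2 := by gcongr; nlinarith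
    linarith
  rcases le_or_gt (1 / 2) x with h1 | h1
  · have : (2 * x - 1) ^ 2 ≤ (1 - u * x) ^ 2 := by
      have : 2 * x - 1 ≤ u * x - 1 := by nlinarith
      nlinarith
    nlinarith
  · rcases le_or_gt 0 x with h0 | h0
    · nlinarith [sq_nonneg (1 - u * x)]
    · have : 0 ≤ 1 - u * x - (-x) := by nlinarith
      nlinarith

lemma norm_sq_lt_of_step {ρ : ℂ} (hρ : 0 < ρ.im) (h1 : ‖ρ‖ < 1) (h2 : ‖red (-1 / ρ)‖ < 1) :
    ‖ρ‖ ^ 2 < 1 - ρ.im ^ 2 := by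
  have hρ0 := ne_zero_of_im_pos hρ
  obtain ⟨n, hn⟩ := red_eq_sub (-1 / ρ)
  have hpos := norm_pos_iff.2 hρ0
  have h3 : ‖1 + 2 * n * ρ‖ < ‖ρ‖ := by
    have : red (-1 / ρ) = -((1 + 2 * n * ρ) / ρ) := by rw [hn]; field_simp; ring
    rw [this, norm_neg, norm_div, div_lt_one hpos] at h2
    exact h2
  have hn0 : n ≠ 0 := by
    rintro rfl
    simp at h3
    linarith
  have h4 := pow_lt_pow_left₀ h3 (norm_nonneg _) two_ne_zero
  have hr : ‖ρ‖ ^ 2 < 1 := by nlinarith [norm_nonneg ρ]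
  rw [norm_sq_eq, norm_sq_eq] at h4
  rw [norm_sq_eq] at hr ⊢
  simp at h4
  have hx : |ρ.re| < 1 := (sq_lt_one_iff_abs_lt_one _).1 (by nlinarith)
  rw [abs_lt] at hx
  rcases lt_or_gt_of_ne hn0 with h | h
  · have : (n : ℝ) ≤ -1 := by exact_mod_cast Int.le_sub_one_of_lt h
    have := sq_lt_of_sq_lt (u := -2 * n) (x := ρ.re) (y := ρ.im) (by linarith) (by nlinarith) hx.2
    linarith
  · have : (1 : ℝ) ≤ n := by exact_mod_cast h
    have := sq_lt_of_sq_lt (u := 2 * n) (x := -ρ.re) (y := ρ.im) (by linarith) (by nlinarith)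
      (by linarith)
    nlinarith

lemma acc_of_not {τ : ℂ} (h : ¬(0 < τ.im ∧ ‖red τ‖ < 1)) : Acc Step τ :=
  ⟨_, fun _ hσ => (h hσ.1).elim⟩

lemma im_le_norm_red (τ : ℂ) : τ.im ≤ ‖red τ‖ := by
  rw [← red_im]; exact (le_abs_self _).trans (abs_im_le_norm _)

lemma neg_one_div_im (τ : ℂ) : (-1 / τ).im = τ.im / ‖τ‖ ^ 2 := by
  rw [← normSq_eq_norm_sq]; simp [neg_div]

lemma step_wellFounded : WellFounded Step := by
  refine ⟨fun τ₀ => ?_⟩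
  by_cases h0 : 0 < τ₀.im ∧ ‖red τ₀‖ < 1
  swap
  · exact acc_of_not h0
  set h := τ₀.im
  have hh : h < 1 := (im_le_norm_red τ₀).trans_lt h0.2
  have hh2 : 0 < 1 - h ^ 2 := by nlinarith [h0.1]
  have key : ∀ k : ℕ, ∀ τ : ℂ, h ≤ τ.im → (1 - h ^ 2) ^ k < τ.im → Acc Step τ := by
    intro k
    induction k with
    | zero =>
      intro τ _ h1
      exact acc_of_not fun h2 => by linarith [im_le_norm_red τ, h2.2]
    | succ k ih =>
      intro τ hτ h1
      refine ⟨_, ?_⟩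
      rintro σ ⟨⟨h2, h3⟩, rfl⟩
      by_cases h4 : 0 < (-1 / red τ).im ∧ ‖red (-1 / red τ)‖ < 1
      swap
      · exact acc_of_not h4
      have hpos : 0 < (red τ).im := by rwa [red_im]
      have h5 := norm_sq_lt_of_step hpos h3 h4.2
      have h6 : 0 < ‖red τ‖ ^ 2 := by
        have := norm_pos_iff.2 (ne_zero_of_im_pos hpos)
        positivity
      rw [red_im] at h5
      have h7 : ‖red τ‖ ^ 2 ≤ 1 - h ^ 2 := by nlinarith [h0.1]
      refine ih _ ?_ ?_
      · rw [neg_one_div_im, red_im, le_div_iff₀ h6]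
        nlinarith [h0.1]
      · rw [neg_one_div_im, red_im, lt_div_iff₀ h6]
        refine lt_of_le_of_lt ?_ h1
        rw [pow_succ]
        exact mul_le_mul_of_nonneg_left h7 (pow_nonneg hh2.le k)
  obtain ⟨k, hk⟩ := exists_pow_lt_of_lt_one h0.1 (show 1 - h ^ 2 < 1 by nlinarith [h0.1])
  exact key k τ₀ le_rfl hk

lemma exists_extension (F : ℂ → ℂ) (A₀ : Bool → ℂ → ℂ) : ∃ A : Bool → ℂ → ℂ, ∀ b τ,
    (0 < τ.im → ‖red τ‖ < 1 → A b τ = flip F b (red τ) - A (!b) (-1 / red τ)) ∧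
    (¬(0 < τ.im ∧ ‖red τ‖ < 1) → A b τ = A₀ b τ) := by
  classical
  let A : ℂ → Bool → ℂ := step_wellFounded.fix fun τ ih b =>
    if h : 0 < τ.im ∧ ‖red τ‖ < 1 then flip F b (red τ) - ih (-1 / red τ) ⟨h, rfl⟩ (!b)
    else A₀ b τ
  refine ⟨fun b τ => A τ b, fun b τ => ⟨fun h1 h2 => ?_, fun h => ?_⟩⟩
  · change A τ b = _
    simp only [A]
    rw [WellFounded.fix_eq]
    exact dif_pos ⟨h1, h2⟩
  · change A τ b = _
    simp only [A]
    rw [WellFounded.fix_eq]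
    exact dif_neg h

lemma differentiableAt_of_red {A : ℂ → ℂ} (hA : Function.Periodic A 2) {τ : ℂ}
    (h : DifferentiableAt ℂ A (red τ)) : DifferentiableAt ℂ A τ := by
  obtain ⟨n, hn⟩ := red_eq_sub τ
  rw [hn] at h
  have h2 : A = fun σ => A (σ - 2 * n) := by
    funext σ
    rw [mul_comm]
    exact (hA.sub_int_mul_eq n).symm
  rw [h2]
  exact DifferentiableAt.comp τ h (by fun_prop)

/-- Every holomorphic function on the upper half-plane is the sum of a `2`-periodic holomorphic
function and the transform under `τ ↦ -1 / τ` of another one, both bounded at `i∞`. -/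
theorem exists_periodic_decomposition {F : ℂ → ℂ} (hF : DifferentiableOn ℂ F upperHalf) :
    ∃ A : Bool → ℂ → ℂ, (∀ b, Function.Periodic (A b) 2) ∧
      (∀ b, DifferentiableOn ℂ (A b) upperHalf) ∧
      (∃ H C : ℝ, ∀ b (τ : ℂ), H ≤ τ.im → ‖A b τ‖ ≤ C) ∧
      ∀ τ, 0 < τ.im → F τ = A true τ + A false (-1 / τ) := by
  obtain ⟨A₀, hA₀⟩ := exists_localSolution hF
  obtain ⟨A, hA⟩ := exists_extension F A₀
  have hper : ∀ b, Function.Periodic (A b) 2 := by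
    intro b τ
    by_cases h : 0 < τ.im ∧ ‖red τ‖ < 1
    · rw [(hA b τ).1 h.1 h.2, (hA b (τ + 2)).1 (by simpa using h.1) (by rw [red_add_two]; exact h.2),
        red_add_two]
    · rw [(hA b τ).2 h, (hA b (τ + 2)).2 (by simpa [red_add_two] using h), hA₀.periodic]
  have hout : ∀ b τ, 1 ≤ ‖red τ‖ → A b τ = A₀ b τ := fun b τ h =>
    (hA b τ).2 fun h' => by linarith [h'.2]
  have hin : ∀ b τ, 0 < τ.im → ‖τ‖ < 1 → A b τ = flip F b τ - A (!b) (-1 / τ) := by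
    intro b τ hτ h
    have hr := red_eq_self_of_norm_le hτ h.le
    simpa only [hr] using (hA b τ).1 hτ (by rwa [hr])
  have hdiff : ∀ τ, 0 < τ.im → ∀ b, DifferentiableAt ℂ (A b) τ := by
    intro τ
    induction τ using step_wellFounded.induction with
    | _ τ ih =>
    intro hτ b
    rcases lt_trichotomy ‖red τ‖ 1 with h | h | h
    · refine differentiableAt_of_red (hper b) ?_
      have hr : 0 < (red τ).im := by rwa [red_im]
      have h1 := ih _ ⟨⟨hτ, h⟩, rfl⟩ (im_neg_one_div_pos hr) (!b)
      have h2 := (differentiableAt_flip hF b hr).sub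
        (h1.comp (red τ) (differentiableAt_neg_one_div (ne_zero_of_im_pos hr)))
      refine h2.congr_of_eventuallyEq ?_
      filter_upwards [upperHalf_mem_nhds hr, continuous_norm.continuousAt.eventually_lt_const h]
        with σ h3 h4 using hin b σ h3 h4
    · refine differentiableAt_of_red (hper b) ?_
      have hr : 0 < (red τ).im := by rwa [red_im]
      obtain ⟨E, hE, hEe⟩ := hA₀.continuation b (red τ) hr h
      refine hE.congr_of_eventuallyEq ?_
      filter_upwards [eventually_one_le_norm_red hr h, hEe] with σ h1 h2
      rcases lt_or_ge ‖σ‖ 1 with h3 | h3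
      · rw [← h2.2 h3, hin b σ h1.1 h3, hout _ _ (h1.2.2 h3).le]
      · rw [← h2.1 h3, hout _ _ (h1.2.1 h3)]
    · refine (hA₀.differentiableAt b τ hτ h).congr_of_eventuallyEq ?_
      filter_upwards [continuous_norm_red.continuousAt.eventually_const_lt h] with σ hσ
        using hout b σ hσ.le
  have hdiffOn : ∀ b, DifferentiableOn ℂ (A b) upperHalf := fun b τ hτ =>
    (hdiff τ hτ b).differentiableWithinAt
  refine ⟨A, hper, hdiffOn, ?_, ?_⟩
  · obtain ⟨H, C, hC⟩ := hA₀.bounded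
    refine ⟨max H 1, C, fun b τ hτ => ?_⟩
    rw [hout b τ ((le_max_right H 1).trans (hτ.trans (im_le_norm_red τ)))]
    exact hC b τ ((le_max_left H 1).trans hτ)
  · have hS : DifferentiableOn ℂ (fun τ => A true τ + A false (-1 / τ)) upperHalf := fun τ hτ =>
      ((hdiff τ hτ true).add ((hdiff _ (im_neg_one_div_pos hτ) false).comp τ
        (differentiableAt_neg_one_div (ne_zero_of_im_pos hτ)))).differentiableWithinAt
    have h0 : (0 : ℝ) < (I / 2).im := by simp
    refine (hF.analyticOnNhd isOpen_upperHalf).eqOn_of_preconnected_of_eventuallyEq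
      (hS.analyticOnNhd isOpen_upperHalf) convex_upperHalf.isPreconnected
      (show I / 2 ∈ upperHalf from h0) ?_
    have h1 : ‖I / 2‖ < 1 := by norm_num
    filter_upwards [upperHalf_mem_nhds h0, continuous_norm.continuousAt.eventually_lt_const h1]
      with τ h2 h3
    simp [hin true τ h2 h3, flip]

lemma qParam_two_pow (τ : ℂ) (n : ℕ) :
    Function.Periodic.qParam 2 τ ^ n = cexp (I * Real.pi * n * τ) := by
  rw [Function.Periodic.qParam, ← exp_nat_mul]
  congr 1
  push_cast
  ring

/-- The Fourier expansion at `i∞` of a `2`-periodic function. -/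
theorem exists_fourier_expansion {A : ℂ → ℂ} (hper : Function.Periodic A 2)
    (hdiff : DifferentiableOn ℂ A upperHalf) (hb : ∃ H C : ℝ, ∀ τ : ℂ, H ≤ τ.im → ‖A τ‖ ≤ C) :
    ∃ c : ℕ → ℂ, (∀ r : ℝ, 0 < r → r < 1 → ∃ C, ∀ n, ‖c n‖ * r ^ n ≤ C) ∧
      ∀ τ : ℂ, 0 < τ.im → HasSum (fun n : ℕ => c n * cexp (I * Real.pi * n * τ)) (A τ) := by
  have hper' : Function.Periodic A ((2 : ℝ) : ℂ) := by simpa using hper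
  have hd : ∀ τ : ℂ, 0 < τ.im → DifferentiableAt ℂ A τ := fun τ hτ =>
    hdiff.differentiableAt (upperHalf_mem_nhds hτ)
  set G := Function.Periodic.cuspFunction 2 A with hG
  have hG0 : DifferentiableAt ℂ G 0 := by
    refine Function.Periodic.differentiableAt_cuspFunction_zero two_pos hper' ?_ ?_
    · exact eventually_comap.2 ((eventually_gt_atTop 0).mono fun y hy τ h => hd τ (h ▸ hy))
    · obtain ⟨H, C, h⟩ := hb
      refine Asymptotics.IsBigO.of_bound C ?_
      exact eventually_comap.2 ((eventually_ge_atTop H).mono fun y hy τ h' => by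
        simpa using h τ (h' ▸ hy))
  have hGd : DifferentiableOn ℂ G (Metric.ball 0 1) := by
    intro q hq
    rw [mem_ball_zero_iff] at hq
    refine DifferentiableAt.differentiableWithinAt ?_
    rcases eq_or_ne q 0 with rfl | h0
    · exact hG0
    · have hq' := Function.Periodic.qParam_right_inv (h := 2) two_ne_zero h0
      rw [← hq']
      refine Function.Periodic.differentiableAt_cuspFunction two_ne_zero hper' (hd _ ?_)
      rw [Function.Periodic.im_invQParam]
      have := Real.log_neg (norm_pos_iff.2 h0) hq
      have hpi := Real.pi_pos
      exact mul_pos_of_neg_of_neg (by rw [neg_div]; exact neg_neg_of_pos (by positivity)) this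
  have hsum : ∀ q : ℂ, ‖q‖ < 1 →
      HasSum (fun n : ℕ => ((n.factorial : ℂ)⁻¹ * iteratedDeriv n G 0) * q ^ n) (G q) := by
    intro q hq
    refine (hasSum_taylorSeries_on_ball hGd (by simpa using hq)).congr_fun fun n => ?_
    simp only [smul_eq_mul, sub_zero]
    ring
  refine ⟨fun n => (n.factorial : ℂ)⁻¹ * iteratedDeriv n G 0, fun r hr0 hr1 => ?_, fun τ hτ => ?_⟩
  · have h1 := (hsum r (by simpa [abs_of_pos hr0] using hr1)).summable.tendsto_atTop_zero
    obtain ⟨C, hC⟩ := (Metric.isBounded_range_of_tendsto _ h1).exists_norm_le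
    refine ⟨C, fun n => ?_⟩
    simpa [abs_of_pos hr0] using hC _ ⟨n, rfl⟩
  · have h1 := hsum _ (Function.Periodic.norm_qParam_lt_one (h := 2) two_pos hτ)
    rw [hG, Function.Periodic.eq_cuspFunction two_ne_zero hper'] at h1
    simpa only [qParam_two_pow] using h1

end HyperbolicFourier

namespace HyperbolicFourier

open Complex Topology InnerProductSpace

lemma exists_primitive {g : ℂ → ℂ} (hg : DifferentiableOn ℂ g upperHalf) :
    ∃ G : ℂ → ℂ, ∀ τ ∈ upperHalf, HasDerivAt G (g τ) τ := by
  have him : ∀ w : ℂ, ‖w‖ < 1 → 0 < (I * (1 + w) / (1 - w)).im ∧ 1 - w ≠ 0 := by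
    intro w hw
    have h1 : 1 - w ≠ 0 := fun h => by
      rw [← sub_eq_zero.1 h, norm_one] at hw
      exact lt_irrefl _ hw
    refine ⟨?_, h1⟩
    have h2 := normSq_pos.2 h1
    have h3 : ‖w‖ ^ 2 < 1 := by nlinarith [norm_nonneg w]
    rw [norm_sq_eq] at h3
    have h4 : (I * (1 + w) / (1 - w)).im = (1 - (w.re ^ 2 + w.im ^ 2)) / normSq (1 - w) := by
      simp [div_im]
      ring
    rw [h4]
    exact div_pos (by linarith) h2
  have hp : ∀ w : ℂ, 1 - w ≠ 0 → HasDerivAt (fun w : ℂ => I * (1 + w) / (1 - w))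
      (2 * I / (1 - w) ^ 2) w := fun w hw => by
    refine ((((hasDerivAt_id w).const_add 1).const_mul I).div
      ((hasDerivAt_id w).const_sub 1) hw).congr_deriv ?_
    simp only [id_eq]
    ring
  have hh : DifferentiableOn ℂ (fun w => g (I * (1 + w) / (1 - w)) * (2 * I / (1 - w) ^ 2))
      (Metric.ball 0 1) := by
    intro w hw
    obtain ⟨h1, h2⟩ := him w (by simpa using hw)
    have h3 := (hg.differentiableAt (upperHalf_mem_nhds h1)).comp w (hp w h2).differentiableAt
    have h4 : DifferentiableAt ℂ (fun w : ℂ => 2 * I / (1 - w) ^ 2) w :=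
      (differentiableAt_const _).div (by fun_prop) (pow_ne_zero 2 h2)
    exact (h3.mul h4).differentiableWithinAt
  obtain ⟨H, hH⟩ := hh.isExactOn_ball
  refine ⟨fun τ => H ((τ - I) / (τ + I)), fun τ hτ => ?_⟩
  have hτ' : 0 < τ.im := hτ
  have h1 : τ + I ≠ 0 := fun h => by
    have := congrArg im h
    simp at this
    linarith
  have hlt : ‖(τ - I) / (τ + I)‖ < 1 := by
    rw [norm_div, div_lt_one (norm_pos_iff.2 h1), ← sq_lt_sq₀ (norm_nonneg _) (norm_nonneg _),
      norm_sq_eq, norm_sq_eq]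
    simp
    linarith
  have hq : HasDerivAt (fun τ : ℂ => (τ - I) / (τ + I)) (2 * I / (τ + I) ^ 2) τ := by
    refine (((hasDerivAt_id τ).sub_const I).div ((hasDerivAt_id τ).add_const I) h1).congr_deriv ?_
    simp only [id_eq]
    ring
  have h2 : 1 - (τ - I) / (τ + I) = 2 * I / (τ + I) := by
    field_simp
    ring
  have h3 : I * (1 + (τ - I) / (τ + I)) / (1 - (τ - I) / (τ + I)) = τ := by
    rw [h2]
    field_simp
    ring
  have h4 := hH _ (mem_ball_zero_iff.2 hlt)
  simp only [h3] at h4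
  refine (h4.comp τ hq).congr_deriv ?_
  rw [h2]
  field_simp

lemma exists_re_eq_of_harmonic {u : ℂ → ℝ} (hu : HarmonicOnNhd u upperHalf) :
    ∃ F : ℂ → ℂ, DifferentiableOn ℂ F upperHalf ∧ ∀ τ ∈ upperHalf, (F τ).re = u τ := by
  let g := ofRealCLM ∘ (fderiv ℝ u · 1) - I • ofRealCLM ∘ (fderiv ℝ u · I)
  have hg : DifferentiableOn ℂ g upperHalf :=
    fun x hx => (HarmonicAt.differentiableAt_complex_partial (hu x hx)).differentiableWithinAt
  obtain ⟨G, hG⟩ := exists_primitive hg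
  have hGd : DifferentiableOn ℂ G upperHalf :=
    fun x hx => (hG x hx).differentiableAt.differentiableWithinAt
  have hI : I ∈ upperHalf := by simp [upperHalf]
  refine ⟨fun τ => G τ + (u I - (G I).re : ℝ), hGd.add_const _, fun τ hτ => ?_⟩
  have hd : ∀ y ∈ upperHalf, HasFDerivAt (fun z => (G z).re - u z) (0 : ℂ →L[ℝ] ℝ) y := by
    intro y hy
    have h1 := reCLM.hasFDerivAt.comp y ((hG y hy).hasFDerivAt.restrictScalars ℝ)
    have h2 := ((hu y hy).1.differentiableAt two_ne_zero).hasFDerivAt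
    refine (h1.sub h2).congr_fderiv ?_
    ext a
    have h3 : fderiv ℝ u y a = a.re * fderiv ℝ u y 1 + a.im * fderiv ℝ u y I := by
      conv_lhs => rw [show a = a.re • (1 : ℂ) + a.im • (I : ℂ) by simp]
      rw [map_add, map_smul, map_smul]
      simp
    simp [g, h3]
  have := convex_upperHalf.is_const_of_fderivWithin_eq_zero (𝕜 := ℝ)
    (fun y hy => (hd y hy).differentiableAt.differentiableWithinAt)
    (fun y hy => by
      rw [fderivWithin_of_isOpen isOpen_upperHalf hy, (hd y hy).fderiv]) hτ hI
  simp only [add_re, ofReal_re] at this ⊢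
  linarith

theorem exists_decomposition_of_harmonic {f : ℂ → ℂ} (hf : HarmonicOnNhd f upperHalf) :
    ∃ F G : ℂ → ℂ, DifferentiableOn ℂ F upperHalf ∧ DifferentiableOn ℂ G upperHalf ∧
      ∀ τ ∈ upperHalf, f τ = F τ + starRingEnd ℂ (G τ) := by
  obtain ⟨U, hU, hUre⟩ := exists_re_eq_of_harmonic (hf.comp_CLM reCLM)
  obtain ⟨V, hV, hVre⟩ := exists_re_eq_of_harmonic (hf.comp_CLM imCLM)
  refine ⟨fun τ => (U τ + I * V τ) / 2, fun τ => (U τ - I * V τ) / 2,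
    (hU.add (hV.const_mul I)).div_const 2, (hU.sub (hV.const_mul I)).div_const 2, fun τ hτ => ?_⟩
  have h1 := hUre τ hτ
  have h2 := hVre τ hτ
  simp at h1 h2
  apply Complex.ext
  · rw [add_re, conj_re]; simp; linarith
  · rw [add_im, conj_im]; simp; linarith

lemma deriv_deriv_line {f : ℂ → ℂ} {τ v : ℂ} {γ : ℝ → ℂ} {t : ℝ} (hγ : ∀ s, HasDerivAt γ v s)
    (ht : γ t = τ) (hf : ContDiffAt ℝ 2 f τ) :
    deriv (fun s => deriv (fun s' => f (γ s')) s) t = iteratedFDeriv ℝ 2 f τ ![v, v] := by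
  subst ht
  have h1 : ∀ᶠ s in 𝓝 t, deriv (fun s' => f (γ s')) s = fderiv ℝ f (γ s) v := by
    have h2 : ∀ᶠ z in 𝓝 (γ t), ContDiffAt ℝ 2 f z := hf.eventually (by simp)
    filter_upwards [(hγ t).continuousAt.eventually h2] with s hs
    exact ((hs.differentiableAt two_ne_zero).hasFDerivAt.comp_hasDerivAt s (hγ s)).deriv
  rw [EventuallyEq.deriv_eq h1, iteratedFDeriv_two_apply]
  have h3 : DifferentiableAt ℝ (fderiv ℝ f) (γ t) :=
    (hf.fderiv_right (m := 1) (by norm_num)).differentiableAt one_ne_zero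
  have h4 := (h3.hasFDerivAt.comp_hasDerivAt t (hγ t)).clm_apply (hasDerivAt_const t v)
  simpa using h4.deriv

lemma harmonicOnNhd_of_harmonicOnH {f : ℂ → ℂ} (hf : HarmonicOnH f) :
    HarmonicOnNhd f upperHalf := by
  have hc : ∀ τ ∈ upperHalf, ContDiffAt ℝ 2 f τ := by
    intro τ hτ
    have ho : IsOpen {p : ℝ × ℝ | 0 < p.2} := isOpen_lt continuous_const continuous_snd
    have h1 := hf.1.contDiffAt (x := equivRealProdCLM τ) (ho.mem_nhds (by simpa using (show 0 < τ.im from hτ)))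
    have h2 := h1.comp τ equivRealProdCLM.contDiff.contDiffAt
    refine h2.congr_of_eventuallyEq (Eventually.of_forall fun σ => ?_)
    simp [re_add_im]
  intro τ hτ
  refine ⟨hc τ hτ, ?_⟩
  filter_upwards [upperHalf_mem_nhds hτ] with σ hσ
  have h := hf.2 σ hσ
  have hx : ∀ s : ℝ, HasDerivAt (fun x : ℝ => (x : ℂ) + (σ.im : ℂ) * I) 1 s := fun s =>
    ofRealCLM.hasDerivAt.add_const _
  have hy : ∀ s : ℝ, HasDerivAt (fun y : ℝ => (σ.re : ℂ) + (y : ℂ) * I) I s := fun s => by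
    simpa using (ofRealCLM.hasDerivAt.mul_const I).const_add (σ.re : ℂ)
  rw [deriv_deriv_line hx (re_add_im σ) (hc σ hσ), deriv_deriv_line hy (re_add_im σ) (hc σ hσ)] at h
  rw [laplacian_eq_iteratedFDeriv_complexPlane]
  exact h

/-- The two-sided sequence with positive part `c`, conjugate negative part `d` and value `k`
at `0`. -/
def glue (c d : ℕ → ℂ) (k : ℂ) (n : ℤ) : ℂ :=
  if 0 < n then c n.natAbs else if n < 0 then starRingEnd ℂ (d n.natAbs) else k

/-- The Fourier series terms at `τ` and `-1 / τ` together. -/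
def pairTerm (c : Bool → ℕ → ℂ) (τ : ℂ) (n : ℕ) : ℂ :=
  c true n * cexp (I * Real.pi * n * τ) + c false n * cexp (I * Real.pi * n * (-1 / τ))

lemma hfsTerm_natCast_succ (c d : Bool → ℕ → ℂ) (k l τ : ℂ) (n : ℕ) :
    hfsTerm (glue (c true) (d true) k) (glue (c false) (d false) l) τ (n + 1 : ℕ) =
      pairTerm c τ (n + 1) := by
  have h : (0 : ℤ) < (n + 1 : ℕ) := by positivity
  rw [hfsTerm, if_pos h, glue, if_pos h, glue, if_pos h, pairTerm, Int.natAbs_natCast]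
  congr 3
  push_cast
  ring

lemma hfsTerm_neg_succ (c d : Bool → ℕ → ℂ) (k l τ : ℂ) (n : ℕ) :
    hfsTerm (glue (c true) (d true) k) (glue (c false) (d false) l) τ (-(n + 1 : ℤ)) =
      starRingEnd ℂ (pairTerm d τ (n + 1)) := by
  have h : ¬(0 : ℤ) < -(n + 1 : ℤ) := by omega
  have h' : -(n + 1 : ℤ) < 0 := by omega
  have hn : (-(n + 1 : ℤ)).natAbs = n + 1 := by omega
  simp only [hfsTerm, glue, if_neg h, if_pos h', pairTerm, hn, map_add, map_mul, ← exp_conj]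
  congr 3
  · simp
    ring
  · simp
    ring

lemma hasSum_hfsTerm {c d : Bool → ℕ → ℂ} {τ x y : ℂ} (hx : HasSum (pairTerm c τ) x)
    (hy : HasSum (pairTerm d τ) y) (l : ℂ) :
    HasSum (hfsTerm (glue (c true) (d true) (c true 0 + c false 0 +
      starRingEnd ℂ (d true 0 + d false 0))) (glue (c false) (d false) l) τ)
      (x + starRingEnd ℂ y) := by
  set k := c true 0 + c false 0 + starRingEnd ℂ (d true 0 + d false 0) with hk
  have h0 : ∀ c : Bool → ℕ → ℂ, pairTerm c τ 0 = c true 0 + c false 0 := fun c => by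
    simp [pairTerm]
  have h1 : HasSum (fun n : ℕ => hfsTerm (glue (c true) (d true) k) (glue (c false) (d false) l) τ n)
      (x + starRingEnd ℂ (d true 0 + d false 0)) := by
    rw [← hasSum_nat_add_iff' 1]
    have h2 := (hasSum_nat_add_iff' 1).2 hx
    simp only [Finset.range_one, Finset.sum_singleton, hfsTerm_natCast_succ, h0] at h2 ⊢
    convert! h2 using 1
    simp [hfsTerm, glue, hk]
  have h3 : HasSum (fun n : ℕ => hfsTerm (glue (c true) (d true) k) (glue (c false) (d false) l) τ
      (-(n + 1 : ℤ))) (starRingEnd ℂ (y - (d true 0 + d false 0))) := by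
    have h2 := (hasSum_nat_add_iff' 1).2 hy
    simp only [Finset.range_one, Finset.sum_singleton, h0] at h2
    simp only [hfsTerm_neg_succ]
    exact hasSum_conj'.2 h2
  have := HasSum.of_nat_of_neg_add_one h1 h3
  convert! this using 1
  simp

lemma norm_glue_le {c d : ℕ → ℂ} {k : ℂ} {M : ℕ → ℝ} (hc : ∀ n, ‖c n‖ ≤ M n)
    (hd : ∀ n, ‖d n‖ ≤ M n) (hk : ‖k‖ ≤ M 0) (n : ℤ) : ‖glue c d k n‖ ≤ M n.natAbs := by
  rw [glue]
  split_ifs with h1 h2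
  · exact hc _
  · rw [norm_conj]; exact hd _
  · rwa [show n = 0 by omega]

lemma norm_exp_le {τ : ℂ} {δ : ℝ} (hτ : δ ≤ τ.im) {n : ℝ} (hn : 0 ≤ n) :
    ‖cexp (I * Real.pi * n * τ)‖ ≤ Real.exp (-(Real.pi * δ * n)) := by
  rw [norm_exp, Real.exp_le_exp]
  have : (I * Real.pi * n * τ).re = -(Real.pi * n * τ.im) := by
    rw [show I * Real.pi * n * τ = I * ((Real.pi * n : ℝ) * τ) by push_cast; ring, I_mul_re,
      im_ofReal_mul]
  rw [this]
  have := mul_le_mul_of_nonneg_left hτ (mul_nonneg Real.pi_pos.le hn)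
  linarith

lemma norm_hfsTerm_le (a b : ℤ → ℂ) {τ : ℂ} {δ : ℝ} (h1 : δ ≤ τ.im) (h2 : δ ≤ (-1 / τ).im) (n : ℤ) :
    ‖hfsTerm a b τ n‖ ≤ (‖a n‖ + ‖b n‖) * Real.exp (-(Real.pi * δ * |(n : ℝ)|)) := by
  have key : ∀ {σ σ' : ℂ}, ‖σ‖ ≤ Real.exp (-(Real.pi * δ * |(n : ℝ)|)) →
      ‖σ'‖ ≤ Real.exp (-(Real.pi * δ * |(n : ℝ)|)) →
      ‖a n * σ + b n * σ'‖ ≤ (‖a n‖ + ‖b n‖) * Real.exp (-(Real.pi * δ * |(n : ℝ)|)) := by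
    intro σ σ' h h'
    refine (norm_add_le _ _).trans ?_
    rw [norm_mul, norm_mul, add_mul]
    gcongr
  have h3 := norm_exp_le h1 (abs_nonneg (n : ℝ))
  have h4 := norm_exp_le h2 (abs_nonneg (n : ℝ))
  rw [hfsTerm]
  split_ifs with hp hn
  · have : |(n : ℝ)| = n := abs_of_pos (by exact_mod_cast hp)
    refine key ?_ ?_
    · convert! h3 using 2
      rw [this]; norm_cast
    · convert! h4 using 2
      rw [this]; push_cast; congr 1; ring
  · have : |(n : ℝ)| = -n := abs_of_neg (by exact_mod_cast hn)
    refine key ?_ ?_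
    · convert! h3 using 1
      rw [this, ← norm_conj, ← exp_conj]
      simp
    · convert! h4 using 1
      rw [this, ← norm_conj, ← exp_conj]
      congr 2
      simp
      ring
  · obtain rfl : n = 0 := by omega
    simp

lemma exists_hyperbolic_expansion {F : ℂ → ℂ} (hF : DifferentiableOn ℂ F upperHalf) :
    ∃ c : Bool → ℕ → ℂ, (∀ b r, 0 < r → r < 1 → ∃ C : ℝ, ∀ n, ‖c b n‖ * r ^ n ≤ C) ∧
      ∀ τ : ℂ, 0 < τ.im → HasSum (pairTerm c τ) (F τ) := by
  obtain ⟨A, hper, hdiff, ⟨H, C, hb⟩, hFA⟩ := exists_periodic_decomposition hF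
  choose c hc hsum using fun b => exists_fourier_expansion (hper b) (hdiff b) ⟨H, C, hb b⟩
  refine ⟨c, fun b r h0 h1 => hc b r h0 h1, fun τ hτ => ?_⟩
  rw [hFA τ hτ]
  exact (hsum true τ hτ).add (hsum false _ (im_neg_one_div_pos hτ))

lemma le_mul_exp_of_mul_pow_le {x C ε : ℝ} {n : ℕ} (h : x * Real.exp (-ε) ^ n ≤ C) :
    x ≤ C * Real.exp (ε * n) := by
  rw [← Real.exp_nat_mul] at h
  calc x = x * Real.exp (n * -ε) * Real.exp (ε * n) := by
        rw [mul_assoc, ← Real.exp_add]; ring_nf; simp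
    _ ≤ _ := by gcongr

lemma exists_im_lower_bound {K : Set ℂ} (hK : K ⊆ {τ : ℂ | 0 < τ.im}) (hc : IsCompact K) :
    ∃ δ : ℝ, 0 < δ ∧ ∀ τ ∈ K, δ ≤ τ.im ∧ δ ≤ (-1 / τ).im := by
  rcases K.eq_empty_or_nonempty with rfl | hne
  · exact ⟨1, one_pos, by simp⟩
  have hcont : ContinuousOn (fun τ : ℂ => min τ.im (-1 / τ).im) K := by
    intro τ hτ
    have h := (differentiableAt_neg_one_div (ne_zero_of_im_pos (hK hτ))).continuousAt
    have h' : ContinuousAt (fun τ : ℂ => min τ.im (-1 / τ).im) τ :=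
      continuous_im.continuousAt.min (ContinuousAt.comp continuous_im.continuousAt h)
    exact h'.continuousWithinAt
  obtain ⟨σ, hσ, hmin⟩ := hc.exists_isMinOn hne hcont
  exact ⟨_, lt_min (hK hσ) (im_neg_one_div_pos (hK hσ)), fun τ hτ => le_min_iff.1 (hmin hτ)⟩

lemma summable_exp_neg_mul_abs {s : ℝ} (hs : 0 < s) :
    Summable fun n : ℤ => Real.exp (-(s * |(n : ℝ)|)) := by
  have h : Summable fun n : ℕ => Real.exp (-(s * n)) := by
    refine (Real.summable_exp_nat_mul_iff.2 (neg_lt_zero.2 hs)).congr fun n => ?_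
    ring_nf
  exact Summable.of_nat_of_neg (by simpa using h) (by simpa using h)

lemma exists_summable_bound {a b : ℤ → ℂ} (hab : ∀ ε : ℝ, 0 < ε → ∃ C : ℝ, ∀ n : ℤ,
      ‖a n‖ ≤ C * Real.exp (ε * |(n : ℝ)|) ∧ ‖b n‖ ≤ C * Real.exp (ε * |(n : ℝ)|))
    {K : Set ℂ} (hK : K ⊆ {τ : ℂ | 0 < τ.im}) (hc : IsCompact K) :
    ∃ u : ℤ → ℝ, Summable u ∧ ∀ n, ∀ τ ∈ K, ‖hfsTerm a b τ n‖ ≤ u n := by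
  obtain ⟨δ, hδ, hKδ⟩ := exists_im_lower_bound hK hc
  obtain ⟨C, hC⟩ := hab δ hδ
  have hs : 0 < (Real.pi - 1) * δ := mul_pos (by linarith [Real.pi_gt_three]) hδ
  refine ⟨_, (summable_exp_neg_mul_abs hs).mul_left (2 * C), fun n τ hτ => ?_⟩
  refine (norm_hfsTerm_le a b (hKδ τ hτ).1 (hKδ τ hτ).2 n).trans ?_
  calc _ ≤ (2 * C * Real.exp (δ * |(n : ℝ)|)) * Real.exp (-(Real.pi * δ * |(n : ℝ)|)) := by
        gcongr
        linarith [(hC n).1, (hC n).2]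
    _ = _ := by
        rw [mul_assoc, ← Real.exp_add]
        ring_nf

end HyperbolicFourier

open HyperbolicFourier

/-- Every harmonic `f : ℍ → ℂ` admits a harmonic hyperbolic Fourier
series expansion with subexponentially growing coefficients, the series converging
absolutely and uniformly on compact subsets of `ℍ`. -/
theorem statement11 (f : ℂ → ℂ) (hharm : HarmonicOnH f) :
    ∃ a b : ℤ → ℂ,
      (∀ ε : ℝ, 0 < ε → ∃ C : ℝ, ∀ n : ℤ,
        ‖a n‖ ≤ C * Real.exp (ε * |(n : ℝ)|) ∧ ‖b n‖ ≤ C * Real.exp (ε * |(n : ℝ)|)) ∧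
      (∀ τ : ℂ, 0 < τ.im → HasSum (fun n : ℤ => hfsTerm a b τ n) (f τ)) ∧
      (∀ τ : ℂ, 0 < τ.im → Summable (fun n : ℤ => ‖hfsTerm a b τ n‖)) ∧
      (∀ K : Set ℂ, K ⊆ {τ : ℂ | 0 < τ.im} → IsCompact K →
        TendstoUniformlyOn (fun (s : Finset ℤ) (τ : ℂ) => ∑ n ∈ s, hfsTerm a b τ n) f atTop K) := by
  obtain ⟨F, G, hF, hG, hfFG⟩ :=
    exists_decomposition_of_harmonic (harmonicOnNhd_of_harmonicOnH hharm)
  obtain ⟨c, hcb, hc⟩ := exists_hyperbolic_expansion hF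
  obtain ⟨d, hdb, hd⟩ := exists_hyperbolic_expansion hG
  set a := glue (c true) (d true) (c true 0 + c false 0 + starRingEnd ℂ (d true 0 + d false 0))
  set b := glue (c false) (d false) 0
  have hsum : ∀ τ : ℂ, 0 < τ.im → HasSum (fun n : ℤ => hfsTerm a b τ n) (f τ) := fun τ hτ => by
    rw [hfFG τ hτ]
    exact hasSum_hfsTerm (hc τ hτ) (hd τ hτ) 0
  have hab : ∀ ε : ℝ, 0 < ε → ∃ C : ℝ, ∀ n : ℤ,
      ‖a n‖ ≤ C * Real.exp (ε * |(n : ℝ)|) ∧ ‖b n‖ ≤ C * Real.exp (ε * |(n : ℝ)|) := by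
    intro ε hε
    have hr : Real.exp (-ε) < 1 := Real.exp_zero ▸ Real.exp_lt_exp.2 (neg_lt_zero.2 hε)
    choose C hC using fun i => hcb i _ (Real.exp_pos (-ε)) hr
    choose D hD using fun i => hdb i _ (Real.exp_pos (-ε)) hr
    refine ⟨C true + C false + (D true + D false), fun n => ?_⟩
    set M : ℕ → ℝ := fun n => ‖c true n‖ + ‖c false n‖ + (‖d true n‖ + ‖d false n‖) with hM
    have hMle : M n.natAbs ≤ (C true + C false + (D true + D false)) * Real.exp (ε * |(n : ℝ)|) := by
      have hn : |(n : ℝ)| = (n.natAbs : ℕ) := by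
        rw [Nat.cast_natAbs, Int.cast_abs]
      rw [hn]
      refine le_mul_exp_of_mul_pow_le ?_
      simp only [hM, add_mul]
      gcongr <;> first | exact hC _ _ | exact hD _ _
    have h1 : ∀ i m, ‖c i m‖ ≤ M m := by
      rintro (_ | _) m <;> simp only [hM] <;>
        linarith [norm_nonneg (c true m), norm_nonneg (c false m), norm_nonneg (d true m),
          norm_nonneg (d false m)]
    have h2 : ∀ i m, ‖d i m‖ ≤ M m := by
      rintro (_ | _) m <;> simp only [hM] <;>
        linarith [norm_nonneg (c true m), norm_nonneg (c false m), norm_nonneg (d true m),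
          norm_nonneg (d false m)]
    refine ⟨(norm_glue_le (h1 _) (h2 _) ?_ n).trans hMle,
      (norm_glue_le (h1 _) (h2 _) ?_ n).trans hMle⟩
    · refine (norm_add_le _ _).trans ?_
      rw [RCLike.norm_conj]
      exact add_le_add (norm_add_le _ _) (norm_add_le _ _)
    · rw [norm_zero]; exact (norm_nonneg _).trans (h1 true 0)
  refine ⟨a, b, hab, hsum, fun τ hτ => ?_, fun K hK hKc => ?_⟩
  · obtain ⟨u, hu, hle⟩ := exists_summable_bound hab (K := {τ}) (by simpa using hτ)
      isCompact_singleton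
    exact hu.of_nonneg_of_le (fun _ => norm_nonneg _) fun n => hle n τ rfl
  · obtain ⟨u, hu, hle⟩ := exists_summable_bound hab hK hKc
    exact (tendstoUniformlyOn_tsum hu hle).congr_right fun τ hτ => (hsum τ (hK hτ)).tsum_eq

end
end
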